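/- Let k ≥ 1 and n ≥ k+4, and let Z ∈ Mat_{n×(k+4)}(ℝ) be positive. (a) If C ∈ Mat_{k×n}(ℝ) is totally nonnegative of rank k and the (n−1)-th column of C is zero, then ⟨(CZ) j j+1 n−2 n⟩ ≥ 0 for every 1 ≤ j ≤ n−4. (b) If D ∈ CD_{n,k} is a chord diagram with no chord ending at (n−2, n−1) (i.e., no l with j_l = n−2), then ⟨(CZ) j j+1 n−2 n⟩ > 0 for every 1 ≤ j ≤ n−4, every domino matrix C of D satisfying the sign rules, and every positive Z. (c) If D ∈ CD_{n,k} has a chord ending at (n−2, n−1), then there exists 1 ≤ j ≤ n−4 such that ⟨(CZ) j j+1 n−2 n⟩ < 0 for every domino matrix C of D satisfying the sign rules and every positive Z. -/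

import Mathlib

open scoped Classical

noncomputable section

/-- A rectangular `n × r` matrix (with `r ≤ n`) is *positive* if all of its maximal
`r × r` minors (rows selected in increasing order) have positive determinant. -/
def IsPositiveMatrix {n r : ℕ} (Z : Matrix (Fin n) (Fin r) ℝ) : Prop :=
  ∀ f : Fin r → Fin n, StrictMono f → 0 < (Z.submatrix f id).det

/-- A `k × n` matrix is *totally nonnegative* if all of its `k × k` minors
(columns selected in increasing order) have nonnegative determinant. -/
def IsTotallyNonnegRect {k n : ℕ} (C : Matrix (Fin k) (Fin n) ℝ) : Prop :=
  ∀ g : Fin k → Fin n, StrictMono g → 0 ≤ (C.submatrix id g).det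

/-- The row of `Z` whose (1-based) marker is `p`, i.e. the row with index `p - 1`. -/
def markerRow {n r : ℕ} (Z : Matrix (Fin n) (Fin r) ℝ) (p : ℕ) : Fin r → ℝ :=
  if h : p - 1 < n then Z ⟨p - 1, h⟩ else 0

/-- The twistor coordinate `⟨Y a₁ a₂ a₃ a₄⟩`: the determinant of the `(k+4) × (k+4)` matrix
whose rows are the `k` rows of `Y` followed by the rows of `Z` with (1-based) markers
`a 0, a 1, a 2, a 3`. -/
def twistor {n k : ℕ} (Z : Matrix (Fin n) (Fin (k + 4)) ℝ)
    (Y : Matrix (Fin k) (Fin (k + 4)) ℝ) (a : Fin 4 → ℕ) : ℝ :=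
  ((Matrix.fromRows Y (Matrix.of fun t => markerRow Z (a t))).submatrix
    (⇑finSumFinEquiv.symm) id).det

/-- The row space of a matrix: the span of its rows. -/
def rowSpace {k n : ℕ} (A : Matrix (Fin k) (Fin n) ℝ) : Submodule ℝ (Fin n → ℝ) :=
  Submodule.span ℝ (Set.range fun r => A r)

/-- The minor of `A` on the set of rows `S` (taken in increasing order), using all columns;
defined to be `0` if `S` does not have the right cardinality. -/
def rowMinor {N r : ℕ} (A : Matrix (Fin N) (Fin r) ℝ) (S : Finset (Fin N)) : ℝ :=
  if h : S.card = r then (A.submatrix (fun t => (S.orderIsoOfFin h t).1) id).det else 0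

/-- The minor of `C` on the set of columns `J` (taken in increasing order), using all rows;
defined to be `0` if `J` does not have the right cardinality. -/
def colMinor {k N : ℕ} (C : Matrix (Fin k) (Fin N) ℝ) (J : Finset (Fin N)) : ℝ :=
  if h : J.card = k then (C.submatrix id (fun t => (J.orderIsoOfFin h t).1)).det else 0


/-- A chord diagram with `n` markers (labelled `1, …, n`) and `k` chords
`c_l = (tail l, tail l + 1, head l, head l + 1)`. -/
structure ChordDiagram (n k : ℕ) where
  tail : Fin k → ℕ
  head : Fin k → ℕ
  one_le_tail : ∀ l, 1 ≤ tail l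
  tail_add_two_le_head : ∀ l, tail l + 2 ≤ head l
  head_add_two_le : ∀ l, head l + 2 ≤ n
  tail_strictMono : StrictMono tail
  noncrossing : ∀ l m : Fin k, l < m → ¬(tail m < head l ∧ head l < head m)

namespace ChordDiagram

variable {n k : ℕ} (D : ChordDiagram n k)

/-- `c_m` is a descendant of `c_l`. -/
def Descendant (l m : Fin k) : Prop := D.tail l < D.tail m ∧ D.head m ≤ D.head l

/-- The number of descendants of `c_l`. -/
def below (l : Fin k) : ℕ := (Finset.univ.filter fun m => D.Descendant l m).card

/-- `c_l` is a top chord: it has no ancestor. -/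
def IsTop (l : Fin k) : Prop := ∀ m, ¬ D.Descendant m l

/-- `c_m` is the parent of `c_l`: the ancestor of `c_l` with the largest start. -/
def IsParent (m l : Fin k) : Prop :=
  D.Descendant m l ∧ ∀ m', D.Descendant m' l → D.tail m' ≤ D.tail m

/-- The number of chords starting after the start of `c_l` (equals `k - l` for the
`l`-th chord in the 1-based start-increasing ordering). -/
def behind (l : Fin k) : ℕ := (Finset.univ.filter fun m => D.tail l < D.tail m).card

/-- The number of descendants of `c_m` (the parent of `c_l`) that come before `c_l`
(equals `l - m - 1` in the 1-based start-increasing ordering). -/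
def beyond (l m : Fin k) : ℕ :=
  (Finset.univ.filter fun h => D.Descendant m h ∧ D.tail h < D.tail l).card

/-- The domino matrix of `D` with variables `α, β, γ, δ, ε` : the column with (0-based)
index `a` corresponds to the (1-based) marker `a + 1`. -/
def dominoMatrix (α β γ δ ε : Fin k → ℝ) : Matrix (Fin k) (Fin n) ℝ :=
  Matrix.of fun l a =>
    (if (a : ℕ) + 1 = D.tail l then α l else 0) +
    (if (a : ℕ) + 1 = D.tail l + 1 then β l else 0) +
    (if (a : ℕ) + 1 = D.head l then γ l else 0) +
    (if (a : ℕ) + 1 = D.head l + 1 then δ l else 0) +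
    (if D.IsTop l ∧ (a : ℕ) + 1 = n then ε l else 0) +
    (∑ m : Fin k, if D.IsParent m l then
        (if (a : ℕ) + 1 = D.tail m then ε l * α m else 0) +
        (if (a : ℕ) + 1 = D.tail m + 1 then ε l * β m else 0)
      else 0)

/-- The sign rules for the domino variables of `D`. -/
def SignRules (α β γ δ ε : Fin k → ℝ) : Prop :=
  (∀ l, 0 < α l) ∧ (∀ l, 0 < β l) ∧
  (∀ l, 0 < (-1 : ℝ) ^ D.below l * γ l) ∧
  (∀ l, 0 < (-1 : ℝ) ^ D.below l * δ l) ∧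
  (∀ l, D.IsTop l → 0 < (-1 : ℝ) ^ D.behind l * ε l) ∧
  (∀ l m, D.IsParent m l → 0 < (-1 : ℝ) ^ D.beyond l m * ε l) ∧
  (∀ l m, D.IsParent m l → D.head l = D.head m → δ l / γ l < δ m / γ m) ∧
  (∀ l m, D.head m = D.tail l → δ m / γ m < β l / α l)

end ChordDiagram


/-- The determinant of the columns `g` of a matrix whose columns are indexed by `ℕ`. -/
def columnMinor {k : ℕ} (R : Fin k → ℕ → ℝ) (g : Fin k → ℕ) : ℝ :=
  (Matrix.of fun i t => R i (g t)).det

theorem columnMinor_congr {k : ℕ} {R R' : Fin k → ℕ → ℝ} {g : Fin k → ℕ}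
    (h : ∀ i t, R i (g t) = R' i (g t)) : columnMinor R g = columnMinor R' g := by
  unfold columnMinor
  congr 1
  ext i t
  exact h i t

theorem columnMinor_snoc {k : ℕ} (N : Fin k → ℕ → ℝ) (w : ℕ → ℝ) (g : Fin (k + 1) → ℕ) :
    columnMinor (Fin.snoc N w : Fin (k + 1) → ℕ → ℝ) g =
      ∑ t : Fin (k + 1), (-1) ^ (k + (t : ℕ)) * w (g t) * columnMinor N (g ∘ t.succAbove) := by
  unfold columnMinor
  rw [Matrix.det_succ_row _ (Fin.last k)]
  refine Finset.sum_congr rfl fun t _ => ?_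
  congr 1
  · simp
  · congr 1
    ext i u
    simp

theorem columnMinor_snoc_add {k : ℕ} (N : Fin k → ℕ → ℝ) (w w' : ℕ → ℝ)
    (g : Fin (k + 1) → ℕ) :
    columnMinor (Fin.snoc N (fun p => w p + w' p) : Fin (k + 1) → ℕ → ℝ) g =
      columnMinor (Fin.snoc N w : Fin (k + 1) → ℕ → ℝ) g +
        columnMinor (Fin.snoc N w' : Fin (k + 1) → ℕ → ℝ) g := by
  simp only [columnMinor_snoc, ← Finset.sum_add_distrib]
  refine Finset.sum_congr rfl fun t _ => ?_
  ring

theorem columnMinor_snoc_mul {k : ℕ} (N : Fin k → ℕ → ℝ) (c : ℝ) (w : ℕ → ℝ)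
    (g : Fin (k + 1) → ℕ) :
    columnMinor (Fin.snoc N (fun p => c * w p) : Fin (k + 1) → ℕ → ℝ) g =
      c * columnMinor (Fin.snoc N w : Fin (k + 1) → ℕ → ℝ) g := by
  simp only [columnMinor_snoc, Finset.mul_sum]
  refine Finset.sum_congr rfl fun t _ => ?_
  ring

theorem columnMinor_snoc_eq_zero {k : ℕ} (N : Fin k → ℕ → ℝ) (w : ℕ → ℝ)
    (g : Fin (k + 1) → ℕ) (hw : ∀ t, w (g t) = 0) :
    columnMinor (Fin.snoc N w : Fin (k + 1) → ℕ → ℝ) g = 0 := by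
  rw [columnMinor_snoc]
  exact Finset.sum_eq_zero fun t _ => by rw [hw]; ring

/-- Expansion along a last row with a single entry, when the other rows change sign to the right
of the column of that entry. -/
theorem columnMinor_snoc_single {k : ℕ} (N M : Fin k → ℕ → ℝ) (w : ℕ → ℝ)
    (g : Fin (k + 1) → ℕ) (hg : StrictMono g) (t₀ : Fin (k + 1))
    (hw : ∀ t, t ≠ t₀ → w (g t) = 0)
    (hN : ∀ t, t ≠ t₀ → ∀ l, N l (g t) = if g t < g t₀ then M l (g t) else -M l (g t)) :
    columnMinor (Fin.snoc N w : Fin (k + 1) → ℕ → ℝ) g =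
      w (g t₀) * columnMinor M (g ∘ t₀.succAbove) := by
  rw [columnMinor_snoc, Finset.sum_eq_single t₀ (fun t _ ht => by rw [hw t ht]; ring) (by simp)]
  have hdet : columnMinor N (g ∘ t₀.succAbove) =
      (-1) ^ (k + (t₀ : ℕ)) * columnMinor M (g ∘ t₀.succAbove) := by
    unfold columnMinor
    have hcol : (Matrix.of fun i t => N i ((g ∘ t₀.succAbove) t)) =
        Matrix.of fun i t => (if (t : Fin k).castSucc < t₀ then (1 : ℝ) else -1) *
          (Matrix.of fun i t => M i ((g ∘ t₀.succAbove) t)) i t := by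
      ext i t
      have h := hN _ (Fin.succAbove_ne t₀ t) i
      simp only [Matrix.of_apply, Function.comp_apply, h, hg.lt_iff_lt,
        Fin.succAbove_lt_iff_castSucc_lt]
      split_ifs <;> ring
    rw [hcol, Matrix.det_mul_row]
    congr 1
    rw [Finset.prod_ite, Finset.prod_const_one, one_mul, Finset.prod_const]
    have hcard : (Finset.univ.filter fun t : Fin k => ¬ t.castSucc < t₀).card = k - t₀ := by
      have h1 := Finset.card_filter_add_card_filter_not (s := (Finset.univ : Finset (Fin k)))
        (fun t : Fin k => (t : ℕ) < (t₀ : ℕ))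
      have h2 : (Finset.univ.filter fun t : Fin k => (t : ℕ) < (t₀ : ℕ)).card = t₀ := by
        rw [Fin.card_filter_val_lt]; omega
      simp only [Fin.lt_def, Fin.val_castSucc]
      simp only [Finset.card_univ, Fintype.card_fin] at h1
      omega
    rw [hcard]
    obtain ⟨r, hr⟩ := Nat.exists_eq_add_of_le (Nat.le_of_lt_succ t₀.2)
    rw [show k - (t₀ : ℕ) = r by omega, show k + (t₀ : ℕ) = r + 2 * t₀ by omega, pow_add, pow_mul]
    norm_num
  have hsq : ((-1 : ℝ) ^ (k + (t₀ : ℕ))) * (-1) ^ (k + (t₀ : ℕ)) = 1 := by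
    rw [← pow_add, Even.neg_one_pow ⟨_, rfl⟩]
  rw [hdet]
  linear_combination (w (g t₀) * columnMinor M (g ∘ t₀.succAbove)) * hsq

theorem columnMinor_sub_column {k : ℕ} (R : Fin k → ℕ → ℝ) (g : Fin k → ℕ)
    (hg : Function.Injective g) (t₀ : Fin k) (p : ℕ) (hp : p ≠ g t₀) (ρ : ℝ) :
    columnMinor R g =
      columnMinor (fun i r => if r = p then R i p - ρ * R i (g t₀) else R i r) g := by
  by_cases h : ∃ t, g t = p
  · obtain ⟨t₁, rfl⟩ := h
    unfold columnMinor
    rw [← Matrix.det_updateCol_add_smul_self (Matrix.of fun i t => R i (g t))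
      (i := t₁) (j := t₀) (fun h => hp (by rw [h])) (-ρ)]
    congr 1
    ext i t
    by_cases ht : t = t₁
    · subst ht; simp; ring
    · simp [ht, hg.eq_iff]
  · push Not at h
    exact columnMinor_congr fun i t => by simp [h t]

/-- A last row supported on the columns `g t₀` and `p`, reduced to one entry by a column
operation. -/
theorem columnMinor_snoc_pair {k : ℕ} (N M : Fin k → ℕ → ℝ) (w : ℕ → ℝ)
    (g : Fin (k + 1) → ℕ) (hg : StrictMono g) (t₀ : Fin (k + 1)) (p : ℕ) (ρ : ℝ)
    (hp : p ≠ g t₀) (hwp : w p = ρ * w (g t₀)) (hw : ∀ r, r ≠ p → r ≠ g t₀ → w r = 0)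
    (hN : ∀ l r, r ≠ p → r ≠ g t₀ → N l r = if r < g t₀ then M l r else -M l r)
    (hNp : ∀ l, N l p - ρ * N l (g t₀) = if p < g t₀ then M l p else -M l p) :
    columnMinor (Fin.snoc N w : Fin (k + 1) → ℕ → ℝ) g =
      w (g t₀) * columnMinor M (g ∘ t₀.succAbove) := by
  rw [columnMinor_sub_column _ g hg.injective t₀ p hp ρ]
  have hrow : (fun (i : Fin (k + 1)) r => if r = p then
        (Fin.snoc N w : Fin (k + 1) → ℕ → ℝ) i p -
          ρ * (Fin.snoc N w : Fin (k + 1) → ℕ → ℝ) i (g t₀)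
        else (Fin.snoc N w : Fin (k + 1) → ℕ → ℝ) i r) =
      (Fin.snoc (fun l r => if r = p then N l p - ρ * N l (g t₀) else N l r)
        (fun r => if r = p then w p - ρ * w (g t₀) else w r) : Fin (k + 1) → ℕ → ℝ) := by
    funext i
    refine Fin.lastCases ?_ (fun i => ?_) i <;> simp
  rw [hrow, columnMinor_snoc_single _ M _ g hg t₀]
  · simp [hp.symm]
  · intro t ht
    have ht' : g t ≠ g t₀ := hg.injective.ne ht
    split_ifs with h
    · rw [hwp]; ring
    · exact hw _ h ht'
  · intro t ht l
    have ht' : g t ≠ g t₀ := hg.injective.ne ht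
    by_cases h : g t = p
    · simp only [h, if_true]; exact hNp l
    · simp only [h, if_false]; exact hN l _ h ht'

/-- Exchanging a row `A - s X` with the last row `s A` where `s = ± 1`. -/
theorem columnMinor_snoc_exchange {k : ℕ} (N : Fin k → ℕ → ℝ) (A X : ℕ → ℝ) (m : Fin k) (s : ℝ)
    (hs : s * s = 1) (hN : ∀ p, N m p = A p - s * X p) (g : Fin (k + 1) → ℕ) :
    columnMinor (Fin.snoc N (fun p => s * A p) : Fin (k + 1) → ℕ → ℝ) g =
      columnMinor (Fin.snoc (Function.update N m A) X : Fin (k + 1) → ℕ → ℝ) g := by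
  set F := (Matrix.detRowAlternating : (Fin (k + 1) → ℝ) [⋀^Fin (k + 1)]→ₗ[ℝ] ℝ)
  set P : Fin (k + 1) → Fin (k + 1) → ℝ :=
    fun i t => (Fin.snoc N (fun p => s * A p) : Fin (k + 1) → ℕ → ℝ) i (g t) with hP
  have hne : m.castSucc ≠ Fin.last k := (Fin.castSucc_lt_last m).ne
  set a : Fin (k + 1) → ℝ := fun t => A (g t)
  set x : Fin (k + 1) → ℝ := fun t => X (g t)
  have h1 : columnMinor (Fin.snoc N (fun p => s * A p) : Fin (k + 1) → ℕ → ℝ) g =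
      F (Function.update (Function.update P m.castSucc (a + (-s) • x)) (Fin.last k) (s • a)) := by
    unfold columnMinor
    change F _ = _
    congr 1
    funext i
    refine Fin.lastCases ?_ (fun i => ?_) i
    · funext t; simp [a]
    · rw [Function.update_of_ne (Fin.castSucc_lt_last i).ne]
      by_cases hi : i = m
      · subst hi; funext t; simp [hN, a, x]; ring
      · rw [Function.update_of_ne (by simpa using hi)]; funext t; simp [hP]
  have h2 : columnMinor (Fin.snoc (Function.update N m A) X : Fin (k + 1) → ℕ → ℝ) g =
      F (Function.update (Function.update P m.castSucc a) (Fin.last k) x) := by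
    unfold columnMinor
    change F _ = _
    congr 1
    funext i
    refine Fin.lastCases ?_ (fun i => ?_) i
    · funext t; simp [x, hne.symm]
    · rw [Function.update_of_ne (Fin.castSucc_lt_last i).ne]
      by_cases hi : i = m
      · subst hi; funext t; simp [a]
      · rw [Function.update_of_ne (by simpa using hi)]; funext t; simp [hP, hi]
  have hswap : F (Function.update (Function.update P m.castSucc x) (Fin.last k) a) =
      -F (Function.update (Function.update P m.castSucc a) (Fin.last k) x) := by
    rw [← F.map_swap _ hne]
    congr 1
    funext i
    by_cases hi : i = m.castSucc
    · subst hi; simp [hne]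
    · by_cases hi' : i = Fin.last k
      · subst hi'; simp [hne]
      · simp [Equiv.swap_apply_of_ne_of_ne hi hi', hi, hi']
  have hzero : F (Function.update (Function.update P m.castSucc a) (Fin.last k) a) = 0 :=
    F.map_eq_zero_of_eq _ (by simp [hne]) hne
  rw [h1, h2, F.map_update_smul, Function.update_comm hne, F.map_update_add, F.map_update_smul,
    Function.update_comm hne.symm, Function.update_comm hne.symm, hzero, hswap]
  simp only [smul_eq_mul]
  linear_combination (F (Function.update (Function.update P m.castSucc a) (Fin.last k) x)) * hs

/-- The row with entries `x`, `y` at the markers `c`, `c + 1`. -/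
def domino (x y : ℝ) (c p : ℕ) : ℝ := (if p = c then x else 0) + (if p = c + 1 then y else 0)

theorem domino_left (x y : ℝ) (c : ℕ) : domino x y c c = x := by simp [domino]

theorem domino_right (x y : ℝ) (c : ℕ) : domino x y c (c + 1) = y := by simp [domino]

theorem domino_of_ne {c p : ℕ} (x y : ℝ) (h : p ≠ c) (h' : p ≠ c + 1) : domino x y c p = 0 := by
  simp [domino, h, h']

theorem domino_zero (c p : ℕ) : domino 0 0 c p = 0 := by simp [domino]

namespace ChordDiagram

variable {n k : ℕ}

theorem descendant_iff (D : ChordDiagram n k) {l m : Fin k} :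
    D.Descendant l m ↔ l < m ∧ D.head m ≤ D.head l := by
  unfold Descendant
  rw [D.tail_strictMono.lt_iff_lt]

theorem Descendant.lt {D : ChordDiagram n k} {l m : Fin k} (h : D.Descendant l m) : l < m :=
  (D.descendant_iff.1 h).1

theorem Descendant.trans {D : ChordDiagram n k} {l m r : Fin k} (h : D.Descendant l m)
    (h' : D.Descendant m r) : D.Descendant l r :=
  ⟨h.1.trans h'.1, h'.2.trans h.2⟩

theorem tail_lt (D : ChordDiagram n k) {l m : Fin k} (h : l < m) : D.tail l < D.tail m :=
  D.tail_strictMono h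

/-- A later chord is either to the right of an earlier chord or a descendant of it. -/
theorem head_le_tail_or_descendant (D : ChordDiagram n k) {l m : Fin k} (h : l < m) :
    D.head l ≤ D.tail m ∨ D.Descendant l m := by
  have h1 := D.noncrossing l m h
  by_cases h2 : D.head l ≤ D.tail m
  · exact Or.inl h2
  · exact Or.inr ⟨D.tail_lt h, by by_contra h3; exact h1 ⟨by omega, by omega⟩⟩

/-- Two ancestors of a chord are comparable. -/
theorem Descendant.of_lt {D : ChordDiagram n k} {l m r : Fin k} (hl : D.Descendant l r)
    (hm : D.Descendant m r) (h : l < m) : D.Descendant l m := by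
  refine (D.head_le_tail_or_descendant h).resolve_left fun h1 => ?_
  have := hm.1
  have := D.tail_add_two_le_head r
  have := hl.2
  omega

theorem isTop_or_exists_isParent (D : ChordDiagram n k) (l : Fin k) :
    D.IsTop l ∨ ∃ m, D.IsParent m l := by
  by_cases h : D.IsTop l
  · exact Or.inl h
  · right
    unfold IsTop at h
    push Not at h
    obtain ⟨m, hm, hmax⟩ := (Finset.univ.filter fun m => D.Descendant m l).exists_max_image D.tail
      (by obtain ⟨m, hm⟩ := h; exact ⟨m, by simpa using hm⟩)
    exact ⟨m, by simpa using hm, fun m' hm' => hmax m' (by simpa using hm')⟩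

theorem IsParent.eq {D : ChordDiagram n k} {l m m' : Fin k} (h : D.IsParent m l)
    (h' : D.IsParent m' l) : m = m' :=
  D.tail_strictMono.injective (le_antisymm (h'.2 _ h.1) (h.2 _ h'.1))

theorem IsParent.not_isTop {D : ChordDiagram n k} {l m : Fin k} (h : D.IsParent m l) :
    ¬ D.IsTop l := fun h' => h' m h.1

/-- The diagram without its last chord. -/
def init (D : ChordDiagram n (k + 1)) : ChordDiagram n k where
  tail l := D.tail l.castSucc
  head l := D.head l.castSucc
  one_le_tail _ := D.one_le_tail _
  tail_add_two_le_head _ := D.tail_add_two_le_head _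
  head_add_two_le _ := D.head_add_two_le _
  tail_strictMono _ _ h := D.tail_strictMono (Fin.castSucc_lt_castSucc_iff.2 h)
  noncrossing _ _ h := D.noncrossing _ _ (Fin.castSucc_lt_castSucc_iff.2 h)

theorem init_descendant (D : ChordDiagram n (k + 1)) (l m : Fin k) :
    D.init.Descendant l m ↔ D.Descendant l.castSucc m.castSucc := Iff.rfl

theorem not_descendant_last (D : ChordDiagram n (k + 1)) (l : Fin (k + 1)) :
    ¬ D.Descendant (Fin.last k) l := fun h => (Fin.le_last l).not_gt h.lt

theorem init_isTop (D : ChordDiagram n (k + 1)) (l : Fin k) :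
    D.init.IsTop l ↔ D.IsTop l.castSucc := by
  unfold IsTop
  rw [Fin.forall_fin_succ']
  simp [not_descendant_last, init_descendant]

theorem init_isParent (D : ChordDiagram n (k + 1)) (m l : Fin k) :
    D.init.IsParent m l ↔ D.IsParent m.castSucc l.castSucc := by
  unfold IsParent
  rw [Fin.forall_fin_succ']
  simp only [not_descendant_last, false_imp_iff, and_true]
  rfl

theorem below_castSucc (D : ChordDiagram n (k + 1)) (l : Fin k) :
    D.below l.castSucc =
      D.init.below l + if D.Descendant l.castSucc (Fin.last k) then 1 else 0 := by
  unfold below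
  simp only [Finset.card_filter, Fin.sum_univ_castSucc, init_descendant]

theorem below_last (D : ChordDiagram n (k + 1)) : D.below (Fin.last k) = 0 := by
  unfold below
  simp [not_descendant_last]

theorem below_eq_of_descendant_last (D : ChordDiagram n (k + 1)) (l : Fin (k + 1))
    (h : D.Descendant l (Fin.last k)) : D.below l = k - l := by
  have : (Finset.univ.filter fun m => D.Descendant l m) = Finset.Ioi l := by
    ext m
    simp only [Finset.mem_filter, Finset.mem_univ, true_and, Finset.mem_Ioi]
    refine ⟨Descendant.lt, fun hm => (D.head_le_tail_or_descendant hm).resolve_left fun h1 => ?_⟩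
    have h2 := h.2
    have h3 := D.tail_add_two_le_head (Fin.last k)
    have h4 := D.tail_strictMono.monotone (Fin.le_last m)
    omega
  unfold below
  rw [this, Fin.card_Ioi]
  omega

/-- The linking entries of the row of `c_l`, up to the absolute value of `ε_l`: an entry at `n`
for a top chord, a copy of the tail domino of the parent otherwise. -/
def link (D : ChordDiagram n k) (α β : Fin k → ℝ) (l : Fin k) (p : ℕ) : ℝ :=
  (if D.IsTop l ∧ p = n then (-1 : ℝ) ^ (k + 1 + (l : ℕ)) else 0) +
    ∑ m : Fin k, if D.IsParent m l then
      (-1 : ℝ) ^ ((l : ℕ) + m + 1) * domino (α m) (β m) (D.tail m) p else 0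

theorem link_of_isTop (D : ChordDiagram n k) (α β : Fin k → ℝ) {l : Fin k} (h : D.IsTop l)
    (p : ℕ) : D.link α β l p = if p = n then (-1 : ℝ) ^ (k + 1 + (l : ℕ)) else 0 := by
  have h' : ∀ m, ¬ D.IsParent m l := fun m hm => hm.not_isTop h
  simp [link, h, h']

theorem link_of_isParent (D : ChordDiagram n k) (α β : Fin k → ℝ) {l m : Fin k}
    (h : D.IsParent m l) (p : ℕ) :
    D.link α β l p = (-1 : ℝ) ^ ((l : ℕ) + m + 1) * domino (α m) (β m) (D.tail m) p := by
  unfold link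
  rw [Finset.sum_eq_single m]
  · simp [h, h.not_isTop]
  · intro m' _ hm'
    rw [if_neg fun h' => hm' (h'.eq h)]
  · simp

theorem link_eq_zero (D : ChordDiagram n k) (α β : Fin k → ℝ) (l : Fin k) {p : ℕ}
    (hp : ∀ m, D.tail m + 1 < p) (hn : p ≠ n) : D.link α β l p = 0 := by
  unfold link
  rw [Finset.sum_eq_zero]
  · simp [hn]
  · intro m _
    have := hp m
    rw [domino_of_ne _ _ (by omega) (by omega)]
    simp

/-- The row of `c_l` in the domino matrix in terms of the absolute values of the variables. -/
def signedRow (D : ChordDiagram n k) (α β g d e : Fin k → ℝ) (l : Fin k) (p : ℕ) : ℝ :=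
  domino (α l) (β l) (D.tail l) p + (-1 : ℝ) ^ D.below l * domino (g l) (d l) (D.head l) p +
    e l * D.link α β l p

/-- The sign rules, relaxed to non-strict inequalities, for the absolute values of the
variables. -/
structure WeakRules (D : ChordDiagram n k) (α β g d e : Fin k → ℝ) : Prop where
  α_pos : ∀ l, 0 < α l
  β_pos : ∀ l, 0 < β l
  g_nonneg : ∀ l, 0 ≤ g l
  d_nonneg : ∀ l, 0 ≤ d l
  e_nonneg : ∀ l, 0 ≤ e l
  d_eq_zero : ∀ l, g l = 0 → d l = 0
  same_head : ∀ l m, D.Descendant m l → D.head l = D.head m → d l * g m ≤ d m * g l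
  head_to_tail : ∀ l m, D.head m = D.tail l → d m * α l ≤ β l * g m

theorem WeakRules.init {D : ChordDiagram n (k + 1)} {α β g d e : Fin (k + 1) → ℝ}
    (h : D.WeakRules α β g d e) :
    D.init.WeakRules (fun l => α l.castSucc) (fun l => β l.castSucc) (fun l => g l.castSucc)
      (fun l => d l.castSucc) (fun l => e l.castSucc) where
  α_pos _ := h.α_pos _
  β_pos _ := h.β_pos _
  g_nonneg _ := h.g_nonneg _
  d_nonneg _ := h.d_nonneg _
  e_nonneg _ := h.e_nonneg _
  d_eq_zero _ := h.d_eq_zero _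
  same_head _ _ := h.same_head _ _
  head_to_tail _ _ := h.head_to_tail _ _

/-- The rows of the first `k` chords of `D` in terms of the diagram without the last chord,
bordered by a last row `w`. -/
def bordered (D : ChordDiagram n (k + 1)) (α β g d e : Fin k → ℝ) (w : ℕ → ℝ) :
    Fin (k + 1) → ℕ → ℝ :=
  Fin.snoc (fun l p => if p ≤ D.tail (Fin.last k) + 1 then D.init.signedRow α β g d e l p
    else -D.init.signedRow α β g d e l p) w

theorem init_tail_lt (D : ChordDiagram n (k + 1)) (l : Fin k) :
    D.init.tail l < D.tail (Fin.last k) := D.tail_lt (Fin.castSucc_lt_last l)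

theorem init_head_le_or (D : ChordDiagram n (k + 1)) (l : Fin k) :
    D.init.head l ≤ D.tail (Fin.last k) ∨ D.head (Fin.last k) ≤ D.init.head l :=
  (D.head_le_tail_or_descendant (Fin.castSucc_lt_last l)).imp_right And.right

theorem tail_last_add_four_le (D : ChordDiagram n (k + 1)) : D.tail (Fin.last k) + 4 ≤ n := by
  have := D.tail_add_two_le_head (Fin.last k)
  have := D.head_add_two_le (Fin.last k)
  omega

theorem link_castSucc (D : ChordDiagram n (k + 1)) (α β : Fin (k + 1) → ℝ) (l : Fin k) (p : ℕ) :
    D.link α β l.castSucc p = if p ≤ D.tail (Fin.last k) + 1 then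
      D.init.link (fun l => α l.castSucc) (fun l => β l.castSucc) l p
      else -D.init.link (fun l => α l.castSucc) (fun l => β l.castSucc) l p := by
  have hn := D.tail_last_add_four_le
  rcases D.init.isTop_or_exists_isParent l with h | ⟨m, h⟩
  · rw [link_of_isTop _ _ _ h, link_of_isTop _ _ _ ((D.init_isTop l).1 h)]
    by_cases hp : p = n
    · rw [if_neg (show ¬ p ≤ D.tail (Fin.last k) + 1 by omega), if_pos hp, if_pos hp,
        Fin.val_castSucc]
      ring
    · simp [hp]
  · rw [link_of_isParent _ _ _ h, link_of_isParent _ _ _ ((D.init_isParent m l).1 h)]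
    have h1 := D.init_tail_lt m
    split_ifs with hp
    · rfl
    · change _ * domino _ _ (D.init.tail m) p = _
      rw [domino_of_ne _ _ (by omega) (by omega)]
      simp

theorem signedRow_eq_bordered (D : ChordDiagram n (k + 1)) (α β g d e : Fin (k + 1) → ℝ) :
    D.signedRow α β g d e =
      D.bordered (fun l => α l.castSucc) (fun l => β l.castSucc) (fun l => g l.castSucc)
        (fun l => d l.castSucc) (fun l => e l.castSucc)
        (D.signedRow α β g d e (Fin.last k)) := by
  funext i
  refine Fin.lastCases (by simp [bordered]) (fun l => ?_) i
  funext p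
  simp only [bordered, Fin.snoc_castSucc]
  unfold signedRow
  rw [link_castSucc, below_castSucc]
  have h1 := D.init_tail_lt l
  have h2 := D.tail_add_two_le_head (Fin.last k)
  change domino _ _ (D.init.tail l) p + _ * domino _ _ (D.init.head l) p + _ = _
  split_ifs with hd hp hp
  · have h3 : D.head (Fin.last k) ≤ D.init.head l := hd.2
    rw [domino_of_ne (g _) _ (by omega) (by omega)]
    simp
  · rw [domino_of_ne (α _) _ (by omega) (by omega)]
    ring
  · simp
  · have h3 : D.init.head l ≤ D.tail (Fin.last k) :=
      (D.head_le_tail_or_descendant (Fin.castSucc_lt_last l)).resolve_right hd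
    rw [domino_of_ne (α _) _ (by omega) (by omega), domino_of_ne (g _) _ (by omega) (by omega)]
    ring

theorem init_signedRow_of_lt (D : ChordDiagram n (k + 1)) (α β g d e : Fin k → ℝ) (l : Fin k)
    {p : ℕ} (hp : D.tail (Fin.last k) < p) (hn : p ≠ n) :
    D.init.signedRow α β g d e l p =
      (-1 : ℝ) ^ D.init.below l * domino (g l) (d l) (D.init.head l) p := by
  unfold signedRow
  have h := D.init_tail_lt l
  rw [link_eq_zero _ _ _ _ (fun m => by have := D.init_tail_lt m; omega) hn,
    domino_of_ne (α l) _ (by omega) (by omega)]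
  ring

end ChordDiagram

/-- All minors with increasing columns are nonnegative. -/
def MinorsNonneg {k : ℕ} (R : Fin k → ℕ → ℝ) : Prop :=
  ∀ g : Fin k → ℕ, StrictMono g → 0 ≤ columnMinor R g

theorem strictMono_comp_succAbove {k : ℕ} {g : Fin (k + 1) → ℕ} (hg : StrictMono g)
    (t : Fin (k + 1)) : StrictMono (g ∘ t.succAbove) :=
  hg.comp (Fin.strictMono_succAbove t)

namespace ChordDiagram

variable {n k : ℕ}

theorem columnMinor_tail_pair (D : ChordDiagram n (k + 1)) (α β g d e : Fin k → ℝ) {x y : ℝ}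
    (hy : 0 < y) {f : Fin (k + 1) → ℕ} (hf : StrictMono f) (t₀ : Fin (k + 1))
    (ht₀ : f t₀ = D.tail (Fin.last k) + 1) :
    columnMinor (D.bordered α β g d e (domino x y (D.tail (Fin.last k)))) f =
      y * columnMinor (D.init.signedRow α β
        (fun l => if D.init.head l = D.tail (Fin.last k) then g l - x / y * d l else g l)
        (fun l => if D.init.head l = D.tail (Fin.last k) then 0 else d l) e)
        (f ∘ t₀.succAbove) := by
  have hn := D.tail_last_add_four_le
  set a := D.tail (Fin.last k) with ha
  unfold bordered
  rw [columnMinor_snoc_pair _ (D.init.signedRow α β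
        (fun l => if D.init.head l = a then g l - x / y * d l else g l)
        (fun l => if D.init.head l = a then 0 else d l) e) _ f hf t₀ a (x / y)]
  · rw [ht₀, domino_right]
  · omega
  · rw [ht₀, domino_left, domino_right]; field_simp
  · intro r h1 h2
    exact domino_of_ne _ _ h1 (ht₀ ▸ h2)
  · intro l r h1 h2
    have h3 : D.init.signedRow α β
        (fun l => if D.init.head l = a then g l - x / y * d l else g l)
        (fun l => if D.init.head l = a then 0 else d l) e l r =
        D.init.signedRow α β g d e l r := by
      unfold signedRow
      by_cases h : D.init.head l = a
      · rw [domino_of_ne (c := D.init.head l) _ _ (by omega) (by omega),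
          domino_of_ne (c := D.init.head l) (g l) _ (by omega) (by omega)]
      · simp [h]
    rw [h3]
    have : r ≤ D.tail (Fin.last k) + 1 ↔ r < f t₀ := by omega
    simp only [this]
  · intro l
    have h1 := D.init_head_le_or l
    have h2 := D.tail_add_two_le_head (Fin.last k)
    rw [if_pos (by omega), if_pos (by omega), if_pos (by omega), ht₀,
      D.init_signedRow_of_lt _ _ _ _ _ _ (p := a + 1) (by omega) (by omega)]
    unfold signedRow
    by_cases h : D.init.head l = a
    · simp only [h, domino_left, domino_right, if_true]; ring
    · rw [domino_of_ne (p := a + 1) _ _ (by omega) (by omega)]; simp [h]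

theorem columnMinor_tail_left (D : ChordDiagram n (k + 1)) (α β g d e : Fin k → ℝ) {x y : ℝ}
    {f : Fin (k + 1) → ℕ} (hf : StrictMono f) (t₀ : Fin (k + 1))
    (ht₀ : f t₀ = D.tail (Fin.last k)) (hb : ∀ t, f t ≠ D.tail (Fin.last k) + 1) :
    columnMinor (D.bordered α β g d e (domino x y (D.tail (Fin.last k)))) f =
      x * columnMinor (D.init.signedRow α β g d e) (f ∘ t₀.succAbove) := by
  unfold bordered
  rw [columnMinor_snoc_single _ (D.init.signedRow α β g d e) _ f hf t₀]
  · rw [ht₀, domino_left]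
  · intro t ht
    exact domino_of_ne _ _ (ht₀ ▸ hf.injective.ne ht) (hb t)
  · intro t ht l
    have h1 : f t ≠ f t₀ := hf.injective.ne ht
    have h2 := hb t
    have : f t ≤ D.tail (Fin.last k) + 1 ↔ f t < f t₀ := by omega
    simp only [this]

theorem WeakRules.sub_tail {D : ChordDiagram n (k + 1)} {α β g d e : Fin k → ℝ}
    (h : D.init.WeakRules α β g d e) {x y : ℝ} (hy : 0 < y)
    (hxy : ∀ l, D.init.head l = D.tail (Fin.last k) → d l * x ≤ y * g l) :
    D.init.WeakRules α β
      (fun l => if D.init.head l = D.tail (Fin.last k) then g l - x / y * d l else g l)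
      (fun l => if D.init.head l = D.tail (Fin.last k) then 0 else d l) e where
  α_pos := h.α_pos
  β_pos := h.β_pos
  g_nonneg l := by
    split_ifs with hl
    · have := hxy l hl
      rw [sub_nonneg, div_mul_eq_mul_div, div_le_iff₀ hy]
      linarith
    · exact h.g_nonneg l
  d_nonneg l := by
    split_ifs with hl
    · exact le_rfl
    · exact h.d_nonneg l
  e_nonneg := h.e_nonneg
  d_eq_zero l := by
    split_ifs with hl
    · simp
    · exact h.d_eq_zero l
  same_head l m hlm hh := by
    rw [hh]
    split_ifs with hl
    · simp
    · exact h.same_head l m hlm hh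
  head_to_tail l m hh := by
    have := D.init_tail_lt l
    rw [if_neg (by omega), if_neg (by omega)]
    exact h.head_to_tail l m hh

theorem tail_nonneg (D : ChordDiagram n (k + 1)) {α β g d e : Fin k → ℝ}
    (hD : ∀ g d : Fin k → ℝ, D.init.WeakRules α β g d e →
      MinorsNonneg (D.init.signedRow α β g d e))
    (h : D.init.WeakRules α β g d e) {x y : ℝ} (hx : 0 < x) (hy : 0 < y)
    (hxy : ∀ l, D.init.head l = D.tail (Fin.last k) → d l * x ≤ y * g l) :
    MinorsNonneg (D.bordered α β g d e (domino x y (D.tail (Fin.last k)))) := by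
  intro f hf
  by_cases hb : ∃ t, f t = D.tail (Fin.last k) + 1
  · obtain ⟨t₀, ht₀⟩ := hb
    rw [D.columnMinor_tail_pair α β g d e hy hf t₀ ht₀]
    exact mul_nonneg hy.le (hD _ _ (h.sub_tail hy hxy) _ (strictMono_comp_succAbove hf t₀))
  · push Not at hb
    by_cases ha : ∃ t, f t = D.tail (Fin.last k)
    · obtain ⟨t₀, ht₀⟩ := ha
      rw [D.columnMinor_tail_left α β g d e hf t₀ ht₀ hb]
      exact mul_nonneg hx.le (hD _ _ h _ (strictMono_comp_succAbove hf t₀))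
    · push Not at ha
      exact (columnMinor_snoc_eq_zero _ _ _ fun t => domino_of_ne _ _ (ha t) (hb t)).ge

theorem init_signedRow_eq_zero_of_between (D : ChordDiagram n (k + 1)) (α β g d e : Fin k → ℝ)
    {c : ℕ} (h0 : ∀ l, D.tail (Fin.last k) < D.init.head l → D.init.head l < c →
      g l = 0 ∧ d l = 0) (l : Fin k) {r : ℕ} (hr : D.tail (Fin.last k) + 1 < r) (hc : r < c)
    (hn : r ≠ n) : D.init.signedRow α β g d e l r = 0 := by
  rw [D.init_signedRow_of_lt _ _ _ _ _ _ (by omega) hn]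
  by_cases h : D.init.head l = r ∨ D.init.head l + 1 = r
  · obtain ⟨hg, hd⟩ := h0 l (by omega) (by omega)
    rw [hg, hd, domino_zero, mul_zero]
  · rw [domino_of_ne _ _ (by omega) (by omega), mul_zero]

theorem columnMinor_head_pair (D : ChordDiagram n (k + 1)) (α β g d e : Fin k → ℝ) {x y : ℝ}
    {c : ℕ} (hc : D.tail (Fin.last k) + 1 < c) (hn : c + 2 ≤ n) (hx : 0 < x)
    (h0 : ∀ l, D.tail (Fin.last k) < D.init.head l → D.init.head l < c → g l = 0 ∧ d l = 0)
    {f : Fin (k + 1) → ℕ} (hf : StrictMono f) (t₀ : Fin (k + 1)) (ht₀ : f t₀ = c) :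
    columnMinor (D.bordered α β g d e (domino x y c)) f =
      x * columnMinor (D.init.signedRow α β g
        (fun l => if D.init.head l = c then d l - y / x * g l else d l) e)
        (f ∘ t₀.succAbove) := by
  unfold bordered
  rw [columnMinor_snoc_pair _ (D.init.signedRow α β g
        (fun l => if D.init.head l = c then d l - y / x * g l else d l) e) _ f hf t₀
        (c + 1) (y / x)]
  · rw [ht₀, domino_left]
  · omega
  · rw [ht₀, domino_left, domino_right]; field_simp
  · intro r h1 h2
    exact domino_of_ne _ _ (ht₀ ▸ h2) h1
  · intro l r h1 h2
    have h3 : D.init.signedRow α β g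
        (fun l => if D.init.head l = c then d l - y / x * g l else d l) e l r =
        D.init.signedRow α β g d e l r := by
      unfold signedRow
      by_cases h : D.init.head l = c
      · rw [domino_of_ne (c := D.init.head l) _ _ (by omega) (by omega),
          domino_of_ne (c := D.init.head l) (g l) _ (by omega) (by omega)]
      · simp [h]
    rw [h3]
    split_ifs with h4 h5 h5
    · rfl
    · omega
    · rw [D.init_signedRow_eq_zero_of_between _ _ _ _ _ h0 _ (by omega) (ht₀ ▸ h5) (by omega),
        neg_zero]
    · rfl
  · intro l
    have h1 := D.init_head_le_or l
    have h2 := D.tail_add_two_le_head (Fin.last k)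
    rw [if_neg (by omega), if_neg (by omega), if_neg (by omega), ht₀,
      D.init_signedRow_of_lt _ _ _ _ _ _ (p := c + 1) (by omega) (by omega),
      D.init_signedRow_of_lt _ _ _ _ _ _ (p := c) (by omega) (by omega),
      D.init_signedRow_of_lt _ _ _ _ _ _ (p := c + 1) (by omega) (by omega)]
    by_cases h : D.init.head l = c
    · simp only [h, domino_left, domino_right, if_true]; ring
    · have h3 : domino (g l) (d l) (D.init.head l) c = 0 := by
        by_cases h4 : D.init.head l + 1 = c
        · obtain ⟨hg, hd⟩ := h0 l (by omega) (by omega)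
          rw [hg, hd, domino_zero]
        · exact domino_of_ne _ _ (by omega) (by omega)
      rw [h3]; simp [h]

theorem columnMinor_head_right (D : ChordDiagram n (k + 1)) (α β g d e : Fin k → ℝ) {x y : ℝ}
    {c : ℕ} (hc : D.tail (Fin.last k) + 1 < c) (hn : c + 2 ≤ n)
    (h0 : ∀ l, D.tail (Fin.last k) < D.init.head l → D.init.head l < c → g l = 0 ∧ d l = 0)
    {f : Fin (k + 1) → ℕ} (hf : StrictMono f) (t₀ : Fin (k + 1)) (ht₀ : f t₀ = c + 1)
    (hfc : ∀ t, f t ≠ c) :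
    columnMinor (D.bordered α β g d e (domino x y c)) f =
      y * columnMinor (D.init.signedRow α β g d e) (f ∘ t₀.succAbove) := by
  unfold bordered
  rw [columnMinor_snoc_single _ (D.init.signedRow α β g d e) _ f hf t₀]
  · rw [ht₀, domino_right]
  · intro t ht
    exact domino_of_ne _ _ (hfc t) (ht₀ ▸ hf.injective.ne ht)
  · intro t ht l
    have h1 : f t ≠ f t₀ := hf.injective.ne ht
    have h2 := hfc t
    split_ifs with h4 h5 h5
    · rfl
    · omega
    · rw [D.init_signedRow_eq_zero_of_between _ _ _ _ _ h0 _ (by omega) (by omega) (by omega),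
        neg_zero]
    · rfl

theorem WeakRules.sub_head {D : ChordDiagram n (k + 1)} {α β g d e : Fin k → ℝ}
    (h : D.init.WeakRules α β g d e) {x y : ℝ} {c : ℕ} (hc : D.tail (Fin.last k) + 1 < c)
    (hx : 0 < x) (hxy : ∀ l, D.init.head l = c → y * g l ≤ d l * x) :
    D.init.WeakRules α β g
      (fun l => if D.init.head l = c then d l - y / x * g l else d l) e where
  α_pos := h.α_pos
  β_pos := h.β_pos
  g_nonneg := h.g_nonneg
  d_nonneg l := by
    split_ifs with hl
    · have := hxy l hl
      rw [sub_nonneg, div_mul_eq_mul_div, div_le_iff₀ hx]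
      linarith
    · exact h.d_nonneg l
  e_nonneg := h.e_nonneg
  d_eq_zero l hl := by
    rw [h.d_eq_zero l hl, hl]
    simp
  same_head l m hlm hh := by
    rw [hh]
    have := h.same_head l m hlm hh
    split_ifs with hl
    · linarith
    · exact this
  head_to_tail l m hh := by
    have := D.init_tail_lt l
    rw [if_neg (by omega)]
    exact h.head_to_tail l m hh

theorem head_nonneg (D : ChordDiagram n (k + 1)) {α β g d e : Fin k → ℝ}
    (hD : ∀ g d : Fin k → ℝ, D.init.WeakRules α β g d e →
      MinorsNonneg (D.init.signedRow α β g d e))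
    (h : D.init.WeakRules α β g d e) {x y : ℝ} {c : ℕ}
    (hc : D.tail (Fin.last k) + 1 < c) (hn : c + 2 ≤ n) (hx : 0 ≤ x) (hy : 0 ≤ y)
    (hxy0 : x = 0 → y = 0)
    (h0 : ∀ l, D.tail (Fin.last k) < D.init.head l → D.init.head l < c → g l = 0 ∧ d l = 0)
    (hxy : ∀ l, D.init.head l = c → y * g l ≤ d l * x) :
    MinorsNonneg (D.bordered α β g d e (domino x y c)) := by
  intro f hf
  rcases hx.eq_or_lt with hx0 | hx
  · rw [← hx0, hxy0 hx0.symm]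
    exact (columnMinor_snoc_eq_zero _ _ _ fun t => domino_zero _ _).ge
  by_cases hb : ∃ t, f t = c
  · obtain ⟨t₀, ht₀⟩ := hb
    rw [D.columnMinor_head_pair α β g d e hc hn hx h0 hf t₀ ht₀]
    exact mul_nonneg hx.le (hD _ _ (h.sub_head hc hx hxy) _ (strictMono_comp_succAbove hf t₀))
  · push Not at hb
    by_cases ha : ∃ t, f t = c + 1
    · obtain ⟨t₀, ht₀⟩ := ha
      rw [D.columnMinor_head_right α β g d e hc hn h0 hf t₀ ht₀ hb]
      exact mul_nonneg hy (hD _ _ h _ (strictMono_comp_succAbove hf t₀))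
    · push Not at ha
      exact (columnMinor_snoc_eq_zero _ _ _ fun t => domino_of_ne _ _ (hb t) (ha t)).ge

theorem top_nonneg (D : ChordDiagram n (k + 1)) {α β g d e : Fin k → ℝ}
    (hD : MinorsNonneg (D.init.signedRow α β g d e))
    (h0 : ∀ l, D.tail (Fin.last k) < D.init.head l → g l = 0 ∧ d l = 0) :
    MinorsNonneg (D.bordered α β g d e fun p => if p = n then 1 else 0) := by
  intro f hf
  have hn := D.tail_last_add_four_le
  by_cases hb : ∃ t, f t = n
  · obtain ⟨t₀, ht₀⟩ := hb
    unfold bordered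
    rw [columnMinor_snoc_single _ (D.init.signedRow α β g d e) _ f hf t₀]
    · simp only [ht₀, if_true, one_mul]
      exact hD _ (strictMono_comp_succAbove hf t₀)
    · intro t ht
      exact if_neg (ht₀ ▸ hf.injective.ne ht)
    · intro t ht l
      have h1 : f t ≠ f t₀ := hf.injective.ne ht
      split_ifs with h4 h5 h5
      · rfl
      · omega
      · rw [D.init_signedRow_eq_zero_of_between (c := n) _ _ _ _ _ (fun l h _ => h0 l h) _
          (by omega) (by omega) (by omega), neg_zero]
      · rfl
  · push Not at hb
    exact (columnMinor_snoc_eq_zero _ _ _ fun t => if_neg (hb t)).ge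

theorem WeakRules.zero_at {D : ChordDiagram n k} {α β g d e : Fin k → ℝ}
    (h : D.WeakRules α β g d e) (m : Fin k)
    (hm : ∀ l, D.Descendant m l → D.head l = D.head m → g l = 0 ∧ d l = 0) :
    D.WeakRules α β (Function.update g m 0) (Function.update d m 0) (Function.update e m 0) where
  α_pos := h.α_pos
  β_pos := h.β_pos
  g_nonneg l := by
    by_cases hl : l = m
    · simp [hl]
    · simpa [hl] using h.g_nonneg l
  d_nonneg l := by
    by_cases hl : l = m
    · simp [hl]
    · simpa [hl] using h.d_nonneg l
  e_nonneg l := by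
    by_cases hl : l = m
    · simp [hl]
    · simpa [hl] using h.e_nonneg l
  d_eq_zero l := by
    by_cases hl : l = m
    · simp [hl]
    · simpa [hl] using h.d_eq_zero l
  same_head l m' hlm hh := by
    by_cases hl : l = m
    · simp only [hl, Function.update_self, zero_mul, mul_zero, le_refl]
    · by_cases hm' : m' = m
      · subst hm'
        obtain ⟨hg, hd⟩ := hm l hlm hh
        simp [hl, hg, hd]
      · simpa [hl, hm'] using h.same_head l m' hlm hh
  head_to_tail l m' hh := by
    by_cases hm' : m' = m
    · simp [hm']
    · simpa [hm'] using h.head_to_tail l m' hh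

theorem bordered_update (D : ChordDiagram n (k + 1)) (α β g d e : Fin k → ℝ) (m : Fin k)
    (w : ℕ → ℝ) :
    (Fin.snoc (Function.update (fun l p => if p ≤ D.tail (Fin.last k) + 1 then
        D.init.signedRow α β g d e l p else -D.init.signedRow α β g d e l p) m
          (domino (α m) (β m) (D.init.tail m))) w : Fin (k + 1) → ℕ → ℝ) =
      D.bordered α β (Function.update g m 0) (Function.update d m 0) (Function.update e m 0)
        w := by
  unfold bordered
  congr 1
  funext l p
  by_cases hl : l = m
  · subst hl
    have := D.init_tail_lt l
    simp only [Function.update_self, signedRow, domino_zero, zero_mul, mul_zero, add_zero]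
    split_ifs
    · rfl
    · rw [domino_of_ne _ _ (by omega) (by omega), neg_zero]
  · simp [hl, signedRow]

/-- Replacing the linking entries of the last row by those of the ancestors, one at a time. -/
theorem ancestor_nonneg (D : ChordDiagram n (k + 1)) {α β : Fin k → ℝ}
    (hD : ∀ g d e : Fin k → ℝ, D.init.WeakRules α β g d e →
      MinorsNonneg (D.init.signedRow α β g d e)) (m : Fin k) :
    D.Descendant m.castSucc (Fin.last k) → ∀ g d e : Fin k → ℝ, D.init.WeakRules α β g d e →
      (∀ l : Fin k, m < l → D.Descendant l.castSucc (Fin.last k) → g l = 0 ∧ d l = 0) →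
      MinorsNonneg (D.bordered α β g d e
        fun p => (-1 : ℝ) ^ (k + (m : ℕ) + 1) * domino (α m) (β m) (D.init.tail m) p) := by
  induction m using WellFoundedLT.induction with
  | _ m ih =>
  intro hm g d e h h0
  have hmk := D.below_eq_of_descendant_last _ hm
  rw [below_castSucc, if_pos hm, Fin.val_castSucc] at hmk
  have hmt := D.init_tail_lt m
  have hmh : D.tail (Fin.last k) + 2 ≤ D.init.head m :=
    (D.tail_add_two_le_head (Fin.last k)).trans hm.2
  have hmk' := m.2
  have hanc : ∀ l : Fin k, D.tail (Fin.last k) < D.init.head l →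
      D.Descendant l.castSucc (Fin.last k) := fun l hl =>
    (D.head_le_tail_or_descendant (Fin.castSucc_lt_last l)).resolve_left (not_le.2 hl)
  set s : ℝ := (-1 : ℝ) ^ (k + (m : ℕ) + 1) with hs
  have hss : s * s = 1 := by rw [hs, ← pow_add, Even.neg_one_pow ⟨_, rfl⟩]
  have hbelow : (-1 : ℝ) ^ D.init.below m = s := by
    rw [hs, show k + (m : ℕ) + 1 = D.init.below m + 2 * (m + 1) by omega, pow_add, pow_mul]
    norm_num
  have hrules := h.zero_at m fun l hl hh => h0 l hl.lt (hanc l (by omega))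
  have hzero : ∀ l : Fin k, m < l → D.Descendant l.castSucc (Fin.last k) →
      Function.update g m 0 l = 0 ∧ Function.update d m 0 l = 0 := fun l hl hd => by
    rw [Function.update_of_ne hl.ne', Function.update_of_ne hl.ne']
    exact h0 l hl hd
  have hzero_self : Function.update g m 0 m = 0 ∧ Function.update d m 0 m = 0 := by simp
  have hlink : ∃ Y : ℕ → ℝ, (∀ p, (if p ≤ D.tail (Fin.last k) + 1 then D.init.link α β m p
        else -D.init.link α β m p) = -(s * Y p)) ∧
      MinorsNonneg (D.bordered α β (Function.update g m 0) (Function.update d m 0)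
        (Function.update e m 0) Y) := by
    have hn := D.tail_last_add_four_le
    rcases D.init.isTop_or_exists_isParent m with ht | ⟨q, hq⟩
    · refine ⟨fun p => if p = n then 1 else 0, fun p => ?_, D.top_nonneg (hD _ _ _ hrules) ?_⟩
      · rw [link_of_isTop _ _ _ ht]
        by_cases hp : p = n
        · simp only [if_neg (show ¬ p ≤ D.tail (Fin.last k) + 1 by omega), if_pos hp, hs]
          ring
        · simp [hp]
      · intro l hl
        rcases lt_trichotomy l m with hlm | rfl | hlm
        · exact absurd ((hanc l hl).of_lt hm (Fin.castSucc_lt_castSucc_iff.2 hlm)) (ht l)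
        · exact hzero_self
        · exact hzero l hlm (hanc l hl)
    · have hqm : q < m := hq.1.lt
      have hqK : D.Descendant q.castSucc (Fin.last k) := Descendant.trans (D := D) hq.1 hm
      refine ⟨_, fun p => ?_, ih q hqm hqK _ _ _ hrules fun l hl hd => ?_⟩
      · have hqt := D.init_tail_lt q
        rw [link_of_isParent _ _ _ hq]
        split_ifs with hp
        · rw [← mul_assoc, hs, ← pow_add, ← neg_mul,
            show k + (m : ℕ) + 1 + (k + (q : ℕ) + 1) = m + q + 2 * (k + 1) by ring, pow_succ,
            pow_add _ _ (2 * (k + 1)), pow_mul]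
          norm_num
        · rw [domino_of_ne _ _ (by omega) (by omega)]
          simp
      · rcases lt_trichotomy l m with hlm | rfl | hlm
        · have h1 : D.init.Descendant l m := hd.of_lt hm (Fin.castSucc_lt_castSucc_iff.2 hlm)
          exact absurd (hq.2 l h1) (D.init.tail_lt hl).not_ge
        · exact hzero_self
        · exact hzero l hlm hd
  obtain ⟨Y, hY, hYpos⟩ := hlink
  have hhead : MinorsNonneg (D.bordered α β (Function.update g m 0) (Function.update d m 0)
      (Function.update e m 0) (domino (g m) (d m) (D.init.head m))) := by
    refine D.head_nonneg (fun g d => hD g d _) hrules (by omega) (D.init.head_add_two_le m)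
      (h.g_nonneg m) (h.d_nonneg m) (h.d_eq_zero m) ?_ ?_
    · intro l hl hc
      have hne : l ≠ m := by rintro rfl; omega
      refine hzero l (lt_of_le_of_ne (not_lt.1 fun hlm => ?_) hne.symm) (hanc l hl)
      have h1 := (hanc l hl).of_lt hm (Fin.castSucc_lt_castSucc_iff.2 hlm)
      exact absurd h1.2 (not_le.2 hc)
    · intro l hl
      have hl' : D.tail (Fin.last k) < D.init.head l := by omega
      rcases lt_trichotomy l m with hlm | rfl | hlm
      · rw [Function.update_of_ne hlm.ne, Function.update_of_ne hlm.ne]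
        exact h.same_head m l ((hanc l hl').of_lt hm (Fin.castSucc_lt_castSucc_iff.2 hlm)) hl.symm
      · simp
      · obtain ⟨h1, h2⟩ := hzero l hlm (hanc l hl')
        rw [h1, h2]
        simp
  intro f hf
  unfold bordered
  rw [columnMinor_snoc_exchange _ (domino (α m) (β m) (D.init.tail m))
    (fun p => domino (g m) (d m) (D.init.head m) p + e m * Y p) m s hss ?_ f,
    bordered_update, bordered, columnMinor_snoc_add, columnMinor_snoc_mul]
  · exact add_nonneg (hhead f hf) (mul_nonneg (h.e_nonneg m) (hYpos f hf))
  · intro p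
    have hYp := hY p
    unfold signedRow
    rw [hbelow]
    split_ifs at hYp ⊢ with hp
    · rw [domino_of_ne (c := D.init.head m) _ _ (by omega) (by omega)]
      linear_combination e m * hYp
    · rw [domino_of_ne (c := D.init.tail m) _ _ (by omega) (by omega)]
      linear_combination e m * hYp

theorem last_domino_nonneg (D : ChordDiagram n (k + 1)) {α β g d e : Fin (k + 1) → ℝ}
    (hD : ∀ g d e : Fin k → ℝ,
      D.init.WeakRules (fun l => α l.castSucc) (fun l => β l.castSucc) g d e →
        MinorsNonneg (D.init.signedRow (fun l => α l.castSucc) (fun l => β l.castSucc) g d e))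
    (h : D.WeakRules α β g d e) :
    MinorsNonneg (D.bordered (fun l => α l.castSucc) (fun l => β l.castSucc)
        (fun l => g l.castSucc) (fun l => d l.castSucc) (fun l => e l.castSucc)
        (domino (α (Fin.last k)) (β (Fin.last k)) (D.tail (Fin.last k)))) ∧
      MinorsNonneg (D.bordered (fun l => α l.castSucc) (fun l => β l.castSucc)
        (fun l => g l.castSucc) (fun l => d l.castSucc) (fun l => e l.castSucc)
        (domino (g (Fin.last k)) (d (Fin.last k)) (D.head (Fin.last k)))) ∧
      MinorsNonneg (D.bordered (fun l => α l.castSucc) (fun l => β l.castSucc)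
        (fun l => g l.castSucc) (fun l => d l.castSucc) (fun l => e l.castSucc)
        (D.link α β (Fin.last k))) := by
  refine ⟨D.tail_nonneg (fun g d => hD g d _) h.init (h.α_pos _) (h.β_pos _) fun l hl =>
    h.head_to_tail (Fin.last k) l.castSucc hl, ?_, ?_⟩
  · have h1 := D.tail_add_two_le_head (Fin.last k)
    refine D.head_nonneg (fun g d => hD g d _) h.init (by omega) (D.head_add_two_le _)
      (h.g_nonneg _) (h.d_nonneg _) (h.d_eq_zero _) ?_ ?_
    · intro l hl hc
      have := D.init_head_le_or l
      omega
    · intro l hl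
      exact h.same_head (Fin.last k) l.castSucc ⟨D.init_tail_lt l, hl.ge⟩ hl.symm
  · rcases D.isTop_or_exists_isParent (Fin.last k) with ht | ⟨m, hm⟩
    · have hlink : D.link α β (Fin.last k) = fun p => if p = n then 1 else 0 := by
        funext p
        rw [link_of_isTop _ _ _ ht, Fin.val_last, Even.neg_one_pow ⟨k + 1, by ring⟩]
      rw [hlink]
      refine D.top_nonneg (hD _ _ _ h.init) fun l hl => ?_
      rcases D.head_le_tail_or_descendant (Fin.castSucc_lt_last l) with h1 | h1
      · exact absurd h1 (not_le.2 hl)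
      · exact absurd h1 (ht _)
    · obtain ⟨m, rfl⟩ := Fin.exists_castSucc_eq.2 hm.1.lt.ne
      have hlink : D.link α β (Fin.last k) = fun p => (-1 : ℝ) ^ (k + (m : ℕ) + 1) *
          domino (α m.castSucc) (β m.castSucc) (D.init.tail m) p := by
        funext p
        rw [link_of_isParent _ _ _ hm]
        rfl
      rw [hlink]
      refine D.ancestor_nonneg hD m hm.1 _ _ _ h.init fun l hl hd => ?_
      exact absurd (hm.2 _ hd) (D.init.tail_lt hl).not_ge

theorem columnMinor_signedRow (D : ChordDiagram n (k + 1)) (α β g d e : Fin (k + 1) → ℝ)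
    (f : Fin (k + 1) → ℕ) :
    columnMinor (D.signedRow α β g d e) f =
      columnMinor (D.bordered (fun l => α l.castSucc) (fun l => β l.castSucc)
        (fun l => g l.castSucc) (fun l => d l.castSucc) (fun l => e l.castSucc)
        (domino (α (Fin.last k)) (β (Fin.last k)) (D.tail (Fin.last k)))) f +
      columnMinor (D.bordered (fun l => α l.castSucc) (fun l => β l.castSucc)
        (fun l => g l.castSucc) (fun l => d l.castSucc) (fun l => e l.castSucc)
        (domino (g (Fin.last k)) (d (Fin.last k)) (D.head (Fin.last k)))) f +
      e (Fin.last k) * columnMinor (D.bordered (fun l => α l.castSucc) (fun l => β l.castSucc)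
        (fun l => g l.castSucc) (fun l => d l.castSucc) (fun l => e l.castSucc)
        (D.link α β (Fin.last k))) f := by
  conv_lhs => rw [signedRow_eq_bordered]
  have hrow : D.signedRow α β g d e (Fin.last k) = fun p =>
      (domino (α (Fin.last k)) (β (Fin.last k)) (D.tail (Fin.last k)) p +
        domino (g (Fin.last k)) (d (Fin.last k)) (D.head (Fin.last k)) p) +
      e (Fin.last k) * D.link α β (Fin.last k) p := by
    funext p
    rw [signedRow, below_last, pow_zero, one_mul]
  rw [hrow]
  unfold bordered
  rw [columnMinor_snoc_add, columnMinor_snoc_add, columnMinor_snoc_mul]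

/-- The minors of a matrix satisfying the sign rules are nonnegative. -/
theorem WeakRules.minorsNonneg : ∀ {k : ℕ} {D : ChordDiagram n k} {α β g d e : Fin k → ℝ},
    D.WeakRules α β g d e → MinorsNonneg (D.signedRow α β g d e)
  | 0, _, _, _, _, _, _, _ => fun f _ => by simp [columnMinor]
  | k + 1, D, α, β, g, d, e, h => fun f hf => by
    obtain ⟨h1, h2, h3⟩ := D.last_domino_nonneg (fun _ _ _ h' => h'.minorsNonneg) h
    rw [columnMinor_signedRow]
    exact add_nonneg (add_nonneg (h1 f hf) (h2 f hf)) (mul_nonneg (h.e_nonneg _) (h3 f hf))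

/-- The sign rules, with the strict inequalities which are needed to exhibit a positive minor. -/
structure StrongRules (D : ChordDiagram n k) (α β g d e : Fin k → ℝ) : Prop
    extends D.WeakRules α β g d e where
  g_pos : ∀ l, 0 < g l
  head_to_tail_lt : ∀ l m, D.head m = D.tail l → d m * α l < β l * g m

/-- A column for each chord: the start of the chord to the left of `j`, its second marker to the
right of `j`, and `q` for the chord starting at `j`. -/
def column (D : ChordDiagram n k) (j q : ℕ) (l : Fin k) : ℕ :=
  if D.tail l < j then D.tail l else if D.tail l = j then q else D.tail l + 1

theorem column_injective (D : ChordDiagram n k) {j q : ℕ}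
    (hq : ∀ l, D.tail l = j → q = D.head l ∨ q = D.head l + 1 ∧ n ≤ D.head l + 2) :
    Function.Injective (D.column j q) := by
  have key : ∀ l m, l < m → D.column j q l ≠ D.column j q m := by
    intro l m hlm
    have h1 := D.tail_lt hlm
    have h2 := D.noncrossing l m hlm
    have h3 := D.tail_add_two_le_head l
    have h4 := D.tail_add_two_le_head m
    have h5 := D.head_add_two_le m
    have h6 := hq l
    have h7 := hq m
    unfold column
    split_ifs <;> omega
  intro l m h
  rcases lt_trichotomy l m with hlm | hlm | hlm
  · exact absurd h (key l m hlm)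
  · exact hlm
  · exact absurd h.symm (key m l hlm)

theorem StrongRules.columnMinor_pos : ∀ {k : ℕ} {D : ChordDiagram n k}
    {α β g d e : Fin k → ℝ} {j q : ℕ}, D.StrongRules α β g d e →
    (∀ l, D.tail l = j → q = D.head l ∨ q = D.head l + 1 ∧ n ≤ D.head l + 2 ∧ 0 < d l) →
    ∀ f : Fin k → ℕ, StrictMono f → Set.range f = Set.range (D.column j q) →
      0 < columnMinor (D.signedRow α β g d e) f
  | 0, _, _, _, _, _, _, _, _, _, _, f, _, _ => by simp [columnMinor]
  | k + 1, D, α, β, g, d, e, j, q, h, hq, f, hf, hr => by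
    obtain ⟨h1, h2, h3⟩ := D.last_domino_nonneg (fun _ _ _ h' => h'.minorsNonneg) h.toWeakRules
    have hinit : D.init.StrongRules (fun l => α l.castSucc) (fun l => β l.castSucc)
        (fun l => g l.castSucc) (fun l => d l.castSucc) (fun l => e l.castSucc) :=
      { h.toWeakRules.init with
        g_pos := fun _ => h.g_pos _
        head_to_tail_lt := fun _ _ => h.head_to_tail_lt _ _ }
    have hinj := D.column_injective (j := j) (q := q) fun l hl => (hq l hl).imp_right
      fun h => ⟨h.1, h.2.1⟩
    obtain ⟨t₀, ht₀⟩ : ∃ t, f t = D.column j q (Fin.last k) := by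
      rw [← Set.mem_range, hr]
      exact ⟨_, rfl⟩
    have hr' : Set.range (f ∘ t₀.succAbove) = Set.range (D.init.column j q) := by
      ext p
      constructor
      · rintro ⟨t, rfl⟩
        obtain ⟨l, hl⟩ : f (t₀.succAbove t) ∈ Set.range (D.column j q) := hr ▸ ⟨_, rfl⟩
        obtain ⟨l, rfl⟩ := Fin.exists_castSucc_eq.2 (show l ≠ Fin.last k by
          rintro rfl
          exact Fin.succAbove_ne t₀ t (hf.injective (hl.symm.trans ht₀.symm)))
        exact ⟨l, hl⟩
      · rintro ⟨l, rfl⟩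
        obtain ⟨t, ht⟩ : D.column j q l.castSucc ∈ Set.range f := hr ▸ ⟨_, rfl⟩
        obtain ⟨t, rfl⟩ := Fin.exists_succAbove_eq (show t ≠ t₀ by
          rintro rfl
          exact (Fin.castSucc_lt_last l).ne (hinj (ht.symm.trans ht₀)))
        exact ⟨t, ht⟩
    have hf' := strictMono_comp_succAbove hf t₀
    have hother : D.tail (Fin.last k) ≤ j → ∀ t, t ≠ t₀ → f t < D.tail (Fin.last k) := by
      intro hj t ht
      obtain ⟨t, rfl⟩ := Fin.exists_succAbove_eq ht
      obtain ⟨l, hl⟩ : f (t₀.succAbove t) ∈ Set.range (D.init.column j q) := hr' ▸ ⟨t, rfl⟩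
      have := D.init_tail_lt l
      rw [← hl, column, if_pos (by omega)]
      exact this
    have htail := D.tail_add_two_le_head (Fin.last k)
    have hhead := D.head_add_two_le (Fin.last k)
    have hbetween : ∀ l, D.tail (Fin.last k) < D.init.head l →
        D.init.head l < D.head (Fin.last k) →
          (fun l : Fin k => g l.castSucc) l = 0 ∧ (fun l : Fin k => d l.castSucc) l = 0 :=
      fun l h4 h5 => by have := D.init_head_le_or l; omega
    rw [columnMinor_signedRow]
    have hlink := mul_nonneg (h.e_nonneg (Fin.last k)) (h3 f hf)
    rcases lt_trichotomy (D.tail (Fin.last k)) j with hj | hj | hj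
    · rw [column, if_pos hj] at ht₀
      refine add_pos_of_pos_of_nonneg (add_pos_of_pos_of_nonneg ?_ (h2 f hf)) hlink
      rw [D.columnMinor_tail_left _ _ _ _ _ hf t₀ ht₀ fun t => ?_]
      · exact mul_pos (h.α_pos _) (hinit.columnMinor_pos (fun l => hq l.castSucc) _ hf' hr')
      · by_cases ht : t = t₀
        · rw [ht, ht₀]; omega
        · have := hother hj.le t ht
          omega
    · rw [column, if_neg (by omega), if_pos hj] at ht₀
      refine add_pos_of_pos_of_nonneg (add_pos_of_nonneg_of_pos (h1 f hf) ?_) hlink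
      rcases hq _ hj with hqe | ⟨hqe, -, hd⟩
      · rw [D.columnMinor_head_pair _ _ _ _ _ (by omega) hhead (h.g_pos _) hbetween hf t₀
          (ht₀.trans hqe)]
        refine mul_pos (h.g_pos _) (StrongRules.columnMinor_pos (j := j) (q := q)
          { hinit.toWeakRules.sub_head (by omega) (h.g_pos _) fun l hl =>
              h.same_head (Fin.last k) l.castSucc ⟨D.init_tail_lt l, hl.ge⟩ hl.symm with
            g_pos := hinit.g_pos
            head_to_tail_lt := fun l m hh => ?_ } (fun l hl => ?_) _ hf' hr')
        · have := D.init_tail_lt l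
          rw [if_neg (by omega)]
          exact hinit.head_to_tail_lt l m hh
        · have := D.init_tail_lt l
          omega
      · rw [D.columnMinor_head_right _ _ _ _ _ (by omega) hhead hbetween hf t₀
          (ht₀.trans hqe) fun t => ?_]
        · exact mul_pos hd (hinit.columnMinor_pos (fun l => hq l.castSucc) _ hf' hr')
        · by_cases ht : t = t₀
          · rw [ht, ht₀]; omega
          · have := hother hj.le t ht
            omega
    · rw [column, if_neg (by omega), if_neg (by omega)] at ht₀
      refine add_pos_of_pos_of_nonneg (add_pos_of_pos_of_nonneg ?_ (h2 f hf)) hlink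
      rw [D.columnMinor_tail_pair _ _ _ _ _ (h.β_pos _) hf t₀ ht₀]
      refine mul_pos (h.β_pos _) (StrongRules.columnMinor_pos (j := j) (q := q)
        { hinit.toWeakRules.sub_tail (h.β_pos _) fun l hl =>
            h.head_to_tail (Fin.last k) l.castSucc hl with
          g_pos := fun l => ?_
          head_to_tail_lt := fun l m hh => ?_ } (fun l hl => ?_) _ hf' hr')
      · split_ifs with hl
        · have := h.head_to_tail_lt (Fin.last k) l.castSucc hl
          rw [sub_pos, div_mul_eq_mul_div, div_lt_iff₀ (h.β_pos _)]
          linarith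
        · exact h.g_pos _
      · have := D.init_tail_lt l
        rw [if_neg (by omega), if_neg (by omega)]
        exact hinit.head_to_tail_lt l m hh
      · refine (hq l.castSucc hl).imp_right fun ⟨h4, h5, h6⟩ => ⟨h4, h5, ?_⟩
        have : D.init.head l ≠ D.tail (Fin.last k) := by
          change D.head l.castSucc ≠ _
          omega
        rw [if_neg this]
        exact h6

theorem behind_eq (D : ChordDiagram n k) (l : Fin k) : D.behind l = k - 1 - l := by
  have : (Finset.univ.filter fun m => D.tail l < D.tail m) = Finset.Ioi l := by
    ext m
    simp [D.tail_strictMono.lt_iff_lt]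
  rw [behind, this, Fin.card_Ioi]

theorem IsParent.beyond_eq {D : ChordDiagram n k} {l m : Fin k} (h : D.IsParent m l) :
    D.beyond l m = l - m - 1 := by
  have : (Finset.univ.filter fun r => D.Descendant m r ∧ D.tail r < D.tail l) =
      Finset.Ioo m l := by
    ext r
    simp only [Finset.mem_filter, Finset.mem_univ, true_and, Finset.mem_Ioo,
      D.tail_strictMono.lt_iff_lt]
    refine and_congr_left fun hr => ⟨Descendant.lt, fun hm => ?_⟩
    refine (D.head_le_tail_or_descendant hm).resolve_left fun h1 => ?_
    have h2 := h.1.2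
    have h3 := D.tail_add_two_le_head l
    have h4 := D.tail_lt hr
    omega
  rw [beyond, this, Fin.card_Ioo]

end ChordDiagram

theorem eq_neg_one_pow_mul_abs {m : ℕ} {x : ℝ} (h : 0 < (-1 : ℝ) ^ m * x) :
    x = (-1 : ℝ) ^ m * |x| := by
  rcases neg_one_pow_eq_or ℝ m with hm | hm <;> rw [hm] at h ⊢
  · rw [abs_of_pos (by linarith)]; ring
  · rw [abs_of_neg (by linarith)]; ring

namespace ChordDiagram

theorem SignRules.ratio_lt {D : ChordDiagram n k} {α β γ δ ε : Fin k → ℝ}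
    (h : D.SignRules α β γ δ ε) {m : Fin k} (l : Fin k) :
    D.Descendant m l → D.head l = D.head m → δ l / γ l < δ m / γ m := by
  obtain ⟨-, -, -, -, -, -, hratio, -⟩ := h
  induction l using WellFoundedLT.induction with
  | _ l ih =>
  intro hd hh
  obtain ⟨p, hp⟩ := (D.isTop_or_exists_isParent l).resolve_left fun ht => ht m hd
  have hmp := D.tail_strictMono.le_iff_le.1 (hp.2 m hd)
  have h1 := hp.1.2
  rcases hmp.eq_or_lt with rfl | hmp
  · exact hratio l m hp hh
  · have hdp := hd.of_lt hp.1 hmp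
    have h2 := hdp.2
    exact (hratio l p hp (by omega)).trans (ih p hp.1.lt hdp (by omega))

theorem SignRules.strongRules {D : ChordDiagram n k} {α β γ δ ε : Fin k → ℝ}
    (h : D.SignRules α β γ δ ε) :
    D.StrongRules α β (fun l => |γ l|) (fun l => |δ l|) (fun l => |ε l|) ∧ ∀ l, 0 < |δ l| := by
  have hratio := fun l m => h.ratio_lt (m := m) l
  obtain ⟨hα, hβ, hγ, hδ, -, -, -, hht⟩ := h
  have hγ0 : ∀ l, 0 < |γ l| := fun l => abs_pos.2 (right_ne_zero_of_mul (hγ l).ne')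
  have hδ0 : ∀ l, 0 < |δ l| := fun l => abs_pos.2 (right_ne_zero_of_mul (hδ l).ne')
  have hdiv : ∀ l, δ l / γ l = |δ l| / |γ l| := fun l => by
    conv_lhs => rw [eq_neg_one_pow_mul_abs (hγ l), eq_neg_one_pow_mul_abs (hδ l)]
    exact mul_div_mul_left _ _ (pow_ne_zero _ (by norm_num))
  simp only [hdiv] at hratio hht
  have hlt : ∀ l m, D.head m = D.tail l → |δ m| * α l < β l * |γ m| := fun l m hl =>
    (div_lt_div_iff₀ (hγ0 m) (hα l)).1 (hht l m hl)
  exact ⟨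
    { α_pos := hα
      β_pos := hβ
      g_nonneg := fun l => abs_nonneg _
      d_nonneg := fun l => abs_nonneg _
      e_nonneg := fun l => abs_nonneg _
      d_eq_zero := fun l hl => absurd hl (hγ0 l).ne'
      same_head := fun l m hd hh =>
        ((div_lt_div_iff₀ (hγ0 l) (hγ0 m)).1 (hratio l m hd hh)).le
      head_to_tail := fun l m hl => (hlt l m hl).le
      g_pos := hγ0
      head_to_tail_lt := hlt }, hδ0⟩

theorem SignRules.dominoMatrix_apply {D : ChordDiagram n k} {α β γ δ ε : Fin k → ℝ}
    (h : D.SignRules α β γ δ ε) (l : Fin k) (a : Fin n) :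
    D.dominoMatrix α β γ δ ε l a =
      D.signedRow α β (fun l => |γ l|) (fun l => |δ l|) (fun l => |ε l|) l (a + 1) := by
  obtain ⟨-, -, hγ, hδ, hε, hε', -, -⟩ := h
  have hγδ : (if (a : ℕ) + 1 = D.head l then γ l else 0) +
      (if (a : ℕ) + 1 = D.head l + 1 then δ l else 0) =
        (-1 : ℝ) ^ D.below l * domino |γ l| |δ l| (D.head l) (a + 1) := by
    conv_lhs => rw [eq_neg_one_pow_mul_abs (hγ l), eq_neg_one_pow_mul_abs (hδ l)]
    rw [domino, mul_add]
    congr 1 <;> split_ifs <;> simp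
  have hlink : (if D.IsTop l ∧ (a : ℕ) + 1 = n then ε l else 0) +
      (∑ m : Fin k, if D.IsParent m l then
          (if (a : ℕ) + 1 = D.tail m then ε l * α m else 0) +
          (if (a : ℕ) + 1 = D.tail m + 1 then ε l * β m else 0)
        else 0) = |ε l| * D.link α β l (a + 1) := by
    have hl := l.2
    rcases D.isTop_or_exists_isParent l with ht | ⟨m, hm⟩
    · have h' : ∀ m, ¬ D.IsParent m l := fun m hm => hm.not_isTop ht
      rw [link_of_isTop _ _ _ ht]
      simp only [ht, h', true_and, if_false, Finset.sum_const_zero, add_zero]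
      split_ifs with ha
      · conv_lhs => rw [eq_neg_one_pow_mul_abs (hε l ht), behind_eq]
        rw [show k + 1 + (l : ℕ) = k - 1 - l + 2 * (l + 1) by omega, pow_add, pow_mul]
        norm_num
        ring
      · simp
    · have hml := Fin.lt_def.1 hm.1.lt
      rw [link_of_isParent _ _ _ hm, Finset.sum_eq_single m
        (fun m' _ hm' => if_neg fun h' => hm' (h'.eq hm)) (by simp), if_pos hm,
        if_neg (fun h' => hm.not_isTop h'.1)]
      conv_lhs => rw [eq_neg_one_pow_mul_abs (hε' l m hm), hm.beyond_eq]
      rw [show (l : ℕ) + m + 1 = l - m - 1 + 2 * (m + 1) by omega, pow_add, pow_mul, domino]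
      norm_num
      split_ifs <;> ring
  rw [signedRow, ← hγδ, ← hlink, domino, dominoMatrix, Matrix.of_apply]
  ring

end ChordDiagram

/-- The minor of `Z` on the rows `f` followed by the rows `b`. -/
def appendMinor {n k m : ℕ} (Z : Matrix (Fin n) (Fin (k + m)) ℝ) (b : Fin m → Fin n)
    (f : Fin k → Fin n) : ℝ :=
  (Z.submatrix (Fin.append f b) id).det

theorem twistor_eq_sum {n k : ℕ} (Z : Matrix (Fin n) (Fin (k + 4)) ℝ)
    (C : Matrix (Fin k) (Fin n) ℝ) (a : Fin 4 → ℕ) (b : Fin 4 → Fin n)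
    (hb : ∀ t, markerRow Z (a t) = Z (b t)) :
    twistor Z (C * Z) a = ∑ f : Fin k → Fin n, (∏ i, C i (f i)) * appendMinor Z b f := by
  set F := (((Matrix.detRowAlternating :
    (Fin (k + 4) → ℝ) [⋀^Fin (k + 4)]→ₗ[ℝ] ℝ).domDomCongr
      finSumFinEquiv.symm).toMultilinearMap).currySum
  have hFapp : ∀ (u : Fin k → Fin (k + 4) → ℝ) (v : Fin 4 → Fin (k + 4) → ℝ),
      F u v = Matrix.det (fun i => Sum.elim u v (finSumFinEquiv.symm i)) := fun u v => rfl
  have h1 : twistor Z (C * Z) a = F (fun i => ∑ r, C i r • Z r) (fun t => Z (b t)) := by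
    rw [hFapp]
    unfold twistor
    congr 1
    ext i p
    rcases h : finSumFinEquiv.symm i with i' | t
    · simp [h, Matrix.mul_apply]
    · simp [h, hb]
  rw [h1, MultilinearMap.map_sum, sum_apply]
  refine Finset.sum_congr rfl fun f _ => ?_
  rw [MultilinearMap.map_smul_univ, smul_apply, hFapp, smul_eq_mul]
  congr 2
  ext i p
  obtain ⟨i', rfl⟩ := finSumFinEquiv.surjective i
  rcases i' with i' | t <;> simp

theorem appendMinor_perm {n k m : ℕ} (Z : Matrix (Fin n) (Fin (k + m)) ℝ) (b : Fin m → Fin n)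
    (f : Fin k → Fin n) (σ : Equiv.Perm (Fin k)) :
    appendMinor Z b (f ∘ σ) = Equiv.Perm.sign σ * appendMinor Z b f := by
  have h : Fin.append (f ∘ σ) b = Fin.append f b ∘
      (finSumFinEquiv.permCongr (Equiv.Perm.sumCongr σ (1 : Equiv.Perm (Fin m)))) := by
    funext i
    obtain ⟨i', rfl⟩ := finSumFinEquiv.surjective i
    rcases i' with i' | t <;> simp [Equiv.permCongr_apply]
  have h' := Matrix.det_permute
    (finSumFinEquiv.permCongr (Equiv.Perm.sumCongr σ (1 : Equiv.Perm (Fin m))))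
    (Z.submatrix (Fin.append f b) id)
  rw [Equiv.Perm.sign_permCongr, Equiv.Perm.sign_sumCongr, Equiv.Perm.sign_one, mul_one] at h'
  unfold appendMinor
  rw [h, ← h']
  rfl

theorem factorial_mul_twistor {n k : ℕ} (Z : Matrix (Fin n) (Fin (k + 4)) ℝ)
    (C : Matrix (Fin k) (Fin n) ℝ) (a : Fin 4 → ℕ) (b : Fin 4 → Fin n)
    (hb : ∀ t, markerRow Z (a t) = Z (b t)) :
    (k.factorial : ℝ) * twistor Z (C * Z) a =
      ∑ f : Fin k → Fin n, (C.submatrix id f).det * appendMinor Z b f := by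
  have hσ : ∀ σ : Equiv.Perm (Fin k), twistor Z (C * Z) a =
      ∑ f : Fin k → Fin n, (Equiv.Perm.sign σ : ℝ) * (∏ i, C i (f (σ i))) *
        appendMinor Z b f := by
    intro σ
    rw [twistor_eq_sum Z C a b hb,
      ← Equiv.sum_comp (σ.arrowCongr (Equiv.refl (Fin n))).symm]
    refine Finset.sum_congr rfl fun f _ => ?_
    have : (σ.arrowCongr (Equiv.refl (Fin n))).symm f = f ∘ σ := rfl
    rw [this, appendMinor_perm]
    simp only [Function.comp_apply]
    ring
  calc (k.factorial : ℝ) * twistor Z (C * Z) a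
      = ∑ _σ : Equiv.Perm (Fin k), twistor Z (C * Z) a := by
        simp [Fintype.card_perm]
    _ = ∑ σ : Equiv.Perm (Fin k), ∑ f : Fin k → Fin n,
          (Equiv.Perm.sign σ : ℝ) * (∏ i, C i (f (σ i))) * appendMinor Z b f :=
        Finset.sum_congr rfl fun σ _ => hσ σ
    _ = _ := by
        rw [Finset.sum_comm]
        refine Finset.sum_congr rfl fun f _ => ?_
        rw [← Finset.sum_mul, ← Matrix.det_transpose, Matrix.det_apply']
        rfl

theorem det_mul_appendMinor_sort {n k m : ℕ} (Z : Matrix (Fin n) (Fin (k + m)) ℝ)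
    (C : Matrix (Fin k) (Fin n) ℝ) (b : Fin m → Fin n) (f : Fin k → Fin n) :
    (C.submatrix id f).det * appendMinor Z b f = 0 ∨ ∃ f' : Fin k → Fin n, StrictMono f' ∧
      (C.submatrix id f).det * appendMinor Z b f =
        (C.submatrix id f').det * appendMinor Z b f' := by
  by_cases hf : Function.Injective f
  · refine Or.inr ⟨f ∘ Tuple.sort f, (Tuple.monotone_sort f).strictMono_of_injective
      (hf.comp (Tuple.sort f).injective), ?_⟩
    have h1 := Matrix.det_permute' (Tuple.sort f) (C.submatrix id f)
    rw [Matrix.submatrix_submatrix] at h1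
    simp only [Function.id_comp] at h1
    have h2 : ((Equiv.Perm.sign (Tuple.sort f) : ℤ) : ℝ) *
        ((Equiv.Perm.sign (Tuple.sort f) : ℤ) : ℝ) = 1 := by
      rw [← Int.cast_mul, ← Units.val_mul, Int.units_mul_self]
      simp
    rw [appendMinor_perm, h1]
    linear_combination (-(C.submatrix id f).det * appendMinor Z b f) * h2
  · left
    unfold Function.Injective at hf
    push Not at hf
    obtain ⟨s, t, hst, hne⟩ := hf
    rw [Matrix.det_zero_of_column_eq hne (fun i => by simp [hst]), zero_mul]

/-- The sign of `c • ⟨CZ a⟩` from the signs of the terms of its Cauchy–Binet expansion. -/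
theorem mul_twistor_nonneg {n k : ℕ} {Z : Matrix (Fin n) (Fin (k + 4)) ℝ}
    {C : Matrix (Fin k) (Fin n) ℝ} {a : Fin 4 → ℕ} {b : Fin 4 → Fin n}
    (hb : ∀ t, markerRow Z (a t) = Z (b t)) {c : ℝ}
    (h : ∀ f, StrictMono f → 0 ≤ c * ((C.submatrix id f).det * appendMinor Z b f)) :
    0 ≤ c * twistor Z (C * Z) a := by
  have hk : (0 : ℝ) < k.factorial := by positivity
  refine nonneg_of_mul_nonneg_right (a := (k.factorial : ℝ)) ?_ hk
  rw [mul_left_comm, factorial_mul_twistor Z C a b hb, Finset.mul_sum]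
  refine Finset.sum_nonneg fun f _ => ?_
  rcases det_mul_appendMinor_sort Z C b f with h0 | ⟨f', hf', h0⟩
  · rw [h0, mul_zero]
  · rw [h0]
    exact h f' hf'

theorem mul_twistor_pos {n k : ℕ} {Z : Matrix (Fin n) (Fin (k + 4)) ℝ}
    {C : Matrix (Fin k) (Fin n) ℝ} {a : Fin 4 → ℕ} {b : Fin 4 → Fin n}
    (hb : ∀ t, markerRow Z (a t) = Z (b t)) {c : ℝ}
    (h : ∀ f, StrictMono f → 0 ≤ c * ((C.submatrix id f).det * appendMinor Z b f))
    (h' : ∃ f, 0 < c * ((C.submatrix id f).det * appendMinor Z b f)) :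
    0 < c * twistor Z (C * Z) a := by
  have hk : (0 : ℝ) < k.factorial := by positivity
  refine pos_of_mul_pos_right (a := (k.factorial : ℝ)) ?_ hk.le
  rw [mul_left_comm, factorial_mul_twistor Z C a b hb, Finset.mul_sum]
  obtain ⟨f, hf⟩ := h'
  refine Finset.sum_pos' (fun f _ => ?_) ⟨f, Finset.mem_univ f, hf⟩
  rcases det_mul_appendMinor_sort Z C b f with h0 | ⟨f', hf', h0⟩
  · rw [h0, mul_zero]
  · simpa only [h0] using h f' hf'

/-- The sign of a minor of a positive matrix is the parity of the number of inversions. -/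
theorem IsPositiveMatrix.inversions_mul_det_pos {n r : ℕ} {Z : Matrix (Fin n) (Fin r) ℝ}
    (hZ : IsPositiveMatrix Z) {h : Fin r → Fin n} (hh : Function.Injective h) :
    0 < (∏ j, ∏ i, if i < j then (if h i < h j then (1 : ℝ) else -1) else 1) *
      (Z.submatrix h id).det := by
  set σ := Tuple.sort h
  have hmono : StrictMono (h ∘ σ) :=
    (Tuple.monotone_sort h).strictMono_of_injective (hh.comp σ.injective)
  have hdet : (Z.submatrix (h ∘ σ) id).det = Equiv.Perm.sign σ * (Z.submatrix h id).det :=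
    Matrix.det_permute σ (Z.submatrix h id)
  have hsign : (∏ j, ∏ i, if i < j then (if h i < h j then (1 : ℝ) else -1) else 1) =
      ((Equiv.Perm.sign σ : ℤ) : ℝ) := by
    rw [← Equiv.Perm.sign_inv, Equiv.Perm.sign_eq_prod_prod_Iio]
    push_cast
    refine Finset.prod_congr rfl fun j _ => ?_
    rw [← Finset.prod_filter]
    refine Finset.prod_congr (by ext; simp) fun i _ => ?_
    have : h i < h j ↔ σ⁻¹ i < σ⁻¹ j := by
      rw [← hmono.lt_iff_lt]
      simp
    simp only [this]
    split_ifs <;> simp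
  rw [hsign, ← hdet]
  exact hZ _ hmono

theorem IsPositiveMatrix.prod_mul_appendMinor_pos {n k m : ℕ}
    {Z : Matrix (Fin n) (Fin (k + m)) ℝ} (hZ : IsPositiveMatrix Z) {b : Fin m → Fin n}
    (hb : StrictMono b) {f : Fin k → Fin n} (hf : StrictMono f) (hfb : ∀ s t, f s ≠ b t) :
    0 < (∏ s, ∏ t, if f s < b t then (1 : ℝ) else -1) * appendMinor Z b f := by
  have h := hZ.inversions_mul_det_pos (h := Fin.append f b)
    (Fin.append_injective_iff.2 ⟨hf.injective, hb.injective, hfb⟩)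
  have hff : ∀ i j : Fin k, (if Fin.castAdd m i < Fin.castAdd m j then
      (if f i < f j then (1 : ℝ) else -1) else 1) = 1 := fun i j => by
    split_ifs with h1 h2
    · rfl
    · exact absurd (hf h1) h2
    · rfl
  have hbb : ∀ i j : Fin m, (if Fin.natAdd k i < Fin.natAdd k j then
      (if b i < b j then (1 : ℝ) else -1) else 1) = 1 := fun i j => by
    split_ifs with h1 h2
    · rfl
    · exact absurd (hb ((Fin.natAdd_lt_natAdd_iff k).1 h1)) h2
    · rfl
  have hlt : ∀ (i : Fin k) (j : Fin m), Fin.castAdd m i < Fin.natAdd k j := fun i j =>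
    Fin.lt_def.2 (by simp; omega)
  have hnlt : ∀ (i : Fin m) (j : Fin k), ¬ Fin.natAdd k i < Fin.castAdd m j := fun i j =>
    (hlt j i).not_gt
  rw [Fin.prod_univ_add] at h
  simp only [Fin.prod_univ_add, Fin.append_left, Fin.append_right, hff, hbb, hlt, hnlt, if_true,
    if_false, Finset.prod_const_one, mul_one, one_mul] at h
  rw [Finset.prod_comm]
  exact h

theorem appendMinor_eq_zero {n k m : ℕ} (Z : Matrix (Fin n) (Fin (k + m)) ℝ) {b : Fin m → Fin n}
    {f : Fin k → Fin n} {s : Fin k} {t : Fin m} (h : f s = b t) : appendMinor Z b f = 0 := by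
  have hne : Fin.castAdd m s ≠ Fin.natAdd k t := fun h' => by
    have := congrArg Fin.val h'
    simp only [Fin.val_castAdd, Fin.val_natAdd] at this
    omega
  exact Matrix.det_zero_of_row_eq hne (funext fun p => by simp [h])

theorem exists_strictMono_range_eq {k : ℕ} {c : Fin k → ℕ} (hc : Function.Injective c) :
    ∃ f : Fin k → ℕ, StrictMono f ∧ Set.range f = Set.range c :=
  ⟨c ∘ Tuple.sort c, (Tuple.monotone_sort c).strictMono_of_injective
    (hc.comp (Tuple.sort c).injective), (Tuple.sort c).surjective.range_comp c⟩

section Columns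

variable {n k j : ℕ} {Z : Matrix (Fin n) (Fin (k + 4)) ℝ} {b : Fin 4 → Fin n} {f : Fin k → Fin n}

theorem exists_columns (hj1 : 1 ≤ j) (hjn : j + 4 ≤ n) :
    ∃ b : Fin 4 → Fin n, StrictMono b ∧ ∀ t, (b t : ℕ) + 1 = ![j, j + 1, n - 2, n] t := by
  refine ⟨![⟨j - 1, by omega⟩, ⟨j, by omega⟩, ⟨n - 3, by omega⟩, ⟨n - 1, by omega⟩], ?_, ?_⟩
  · rw [Fin.strictMono_iff_lt_succ]
    intro i
    rw [Fin.lt_def]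
    fin_cases i <;> simp <;> omega
  · intro t
    fin_cases t <;> simp <;> omega

theorem markerRow_eq {p : ℕ} {a : Fin n} (h : (a : ℕ) + 1 = p) : markerRow Z p = Z a := by
  have : p - 1 = a := by omega
  simp [markerRow, this]

theorem prod_inversions (hjn : j + 4 ≤ n)
    (hb : ∀ t, (b t : ℕ) + 1 = ![j, j + 1, n - 2, n] t) {a : Fin n} (ha : ∀ t, a ≠ b t) :
    (∏ t, if a < b t then (1 : ℝ) else -1) = if (a : ℕ) + 2 = n then -1 else 1 := by
  have h0 := hb 0
  have h1 := hb 1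
  have h2 := hb 2
  have h3 := hb 3
  simp at h0 h1 h2 h3
  have a0 := Fin.val_ne_iff.2 (ha 0)
  have a1 := Fin.val_ne_iff.2 (ha 1)
  have a2 := Fin.val_ne_iff.2 (ha 2)
  have a3 := Fin.val_ne_iff.2 (ha 3)
  have := a.2
  simp only [Fin.prod_univ_four, Fin.lt_def]
  split_ifs <;> first | omega | norm_num

theorem appendMinor_pos (hZ : IsPositiveMatrix Z) (hjn : j + 4 ≤ n) (hbm : StrictMono b)
    (hb : ∀ t, (b t : ℕ) + 1 = ![j, j + 1, n - 2, n] t) (hf : StrictMono f)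
    (hfb : ∀ s t, f s ≠ b t) (h : ∀ s, (f s : ℕ) + 2 ≠ n) : 0 < appendMinor Z b f := by
  have := hZ.prod_mul_appendMinor_pos hbm hf hfb
  rwa [Finset.prod_eq_one fun s _ => (prod_inversions hjn hb (hfb s)).trans (if_neg (h s)),
    one_mul] at this

theorem appendMinor_neg (hZ : IsPositiveMatrix Z) (hjn : j + 4 ≤ n) (hbm : StrictMono b)
    (hb : ∀ t, (b t : ℕ) + 1 = ![j, j + 1, n - 2, n] t) (hf : StrictMono f)
    (hfb : ∀ s t, f s ≠ b t) {s : Fin k} (h : (f s : ℕ) + 2 = n) : appendMinor Z b f < 0 := by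
  have := hZ.prod_mul_appendMinor_pos hbm hf hfb
  rw [Finset.prod_eq_single s (fun s' _ hs => (prod_inversions hjn hb (hfb s')).trans
    (if_neg fun h' => hs (hf.injective (Fin.ext (by omega))))) (by simp),
    prod_inversions hjn hb (hfb s), if_pos h] at this
  linarith

theorem det_mul_appendMinor_nonneg (hZ : IsPositiveMatrix Z) (hjn : j + 4 ≤ n)
    (hbm : StrictMono b) (hb : ∀ t, (b t : ℕ) + 1 = ![j, j + 1, n - 2, n] t)
    {C : Matrix (Fin k) (Fin n) ℝ} (hC : IsTotallyNonnegRect C)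
    (hC0 : ∀ r : Fin k, ∀ a : Fin n, (a : ℕ) + 1 = n - 1 → C r a = 0) (hf : StrictMono f) :
    0 ≤ (C.submatrix id f).det * appendMinor Z b f := by
  by_cases hfb : ∀ s t, f s ≠ b t
  · by_cases h : ∀ s, (f s : ℕ) + 2 ≠ n
    · exact mul_nonneg (hC f hf) (appendMinor_pos hZ hjn hbm hb hf hfb h).le
    · push Not at h
      obtain ⟨s, hs⟩ := h
      rw [Matrix.det_eq_zero_of_column_eq_zero s fun r => hC0 r (f s) (by omega), zero_mul]
  · push Not at hfb
    obtain ⟨s, t, hst⟩ := hfb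
    rw [appendMinor_eq_zero Z hst, mul_zero]

theorem forall_ne_columns (hb : ∀ t, (b t : ℕ) + 1 = ![j, j + 1, n - 2, n] t) {a : Fin n}
    (h0 : (a : ℕ) + 1 ≠ j) (h1 : (a : ℕ) + 1 ≠ j + 1) (h2 : (a : ℕ) + 1 ≠ n - 2)
    (h3 : (a : ℕ) + 1 ≠ n) (t : Fin 4) : a ≠ b t := by
  rintro rfl
  rw [hb t] at h0 h1 h2 h3
  fin_cases t <;> simp at h0 h1 h2 h3

end Columns

namespace ChordDiagram

variable {n k : ℕ} {D : ChordDiagram n k} {α β γ δ ε : Fin k → ℝ}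

theorem SignRules.det_submatrix (h : D.SignRules α β γ δ ε) (f : Fin k → Fin n) :
    ((D.dominoMatrix α β γ δ ε).submatrix id f).det =
      columnMinor (D.signedRow α β (fun l => |γ l|) (fun l => |δ l|) fun l => |ε l|)
        fun t => f t + 1 := by
  unfold columnMinor
  congr 1
  ext l t
  exact h.dominoMatrix_apply l (f t)

theorem SignRules.isTotallyNonnegRect (h : D.SignRules α β γ δ ε) :
    IsTotallyNonnegRect (D.dominoMatrix α β γ δ ε) := fun f hf => by
  rw [h.det_submatrix]
  exact h.strongRules.1.toWeakRules.minorsNonneg _ fun s t hst =>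
    Nat.succ_lt_succ (Fin.lt_def.1 (hf hst))

theorem SignRules.exists_det_pos (h : D.SignRules α β γ δ ε) {j q : ℕ}
    (hq : ∀ l, D.tail l = j → q = D.head l ∨ q = D.head l + 1 ∧ n ≤ D.head l + 2) :
    ∃ f : Fin k → Fin n, StrictMono f ∧
      Set.range (fun t => (f t : ℕ) + 1) = Set.range (D.column j q) ∧
      0 < ((D.dominoMatrix α β γ δ ε).submatrix id f).det := by
  obtain ⟨g, hg, hr⟩ := exists_strictMono_range_eq (D.column_injective hq)
  have hbound : ∀ t, 1 ≤ g t ∧ g t ≤ n := fun t => by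
    obtain ⟨l, hl⟩ : g t ∈ Set.range (D.column j q) := hr ▸ ⟨t, rfl⟩
    have h1 := D.one_le_tail l
    have h2 := D.tail_add_two_le_head l
    have h3 := D.head_add_two_le l
    have h4 := hq l
    rw [← hl]
    unfold column
    split_ifs <;> omega
  have hfg : (fun t => g t - 1 + 1) = g := funext fun t => Nat.sub_add_cancel (hbound t).1
  refine ⟨fun t => ⟨g t - 1, by have := hbound t; omega⟩, fun s t hst => ?_, ?_, ?_⟩
  · have h1 := hg hst
    have h2 := hbound s
    rw [Fin.lt_def]
    dsimp only
    omega
  · simpa only [hfg] using hr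
  · rw [h.det_submatrix]
    simp only [hfg]
    exact h.strongRules.1.columnMinor_pos (fun l hl => (hq l hl).imp_right fun h' =>
      ⟨h'.1, h'.2, h.strongRules.2 l⟩) g hg hr

/-- The only nonzero entries of the row of a top chord are at its markers and at `n`. -/
theorem IsTop.signedRow_eq_zero {l : Fin k} (hl : D.IsTop l) (α β g d e : Fin k → ℝ) {p : ℕ}
    (h1 : p ≠ D.tail l) (h2 : p ≠ D.tail l + 1) (h3 : p ≠ D.head l) (h4 : p ≠ D.head l + 1)
    (h5 : p ≠ n) : D.signedRow α β g d e l p = 0 := by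
  rw [signedRow, link_of_isTop _ _ _ hl, domino_of_ne _ _ h1 h2, domino_of_ne _ _ h3 h4,
    if_neg h5]
  simp

theorem SignRules.dominoMatrix_eq_zero (h : D.SignRules α β γ δ ε)
    (hD : ∀ l, D.head l ≠ n - 2) (l : Fin k) (a : Fin n) (ha : (a : ℕ) + 1 = n - 1) :
    D.dominoMatrix α β γ δ ε l a = 0 := by
  have h1 := D.tail_add_two_le_head
  have h2 := D.head_add_two_le
  have h3 := h1 l
  have h4 := h2 l
  have h5 := hD l
  have h6 := D.one_le_tail l
  rw [h.dominoMatrix_apply, signedRow, link_eq_zero _ _ _ _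
    (fun m => by have := h1 m; have := h2 m; omega) (by omega),
    domino_of_ne (c := D.tail l) _ _ (by omega) (by omega),
    domino_of_ne (c := D.head l) _ _ (by omega) (by omega)]
  simp

theorem twistor_pos (hD : ∀ l, D.head l ≠ n - 2) {j : ℕ} (hj1 : 1 ≤ j) (hjn : j + 4 ≤ n)
    (h : D.SignRules α β γ δ ε) {Z : Matrix (Fin n) (Fin (k + 4)) ℝ} (hZ : IsPositiveMatrix Z) :
    0 < twistor Z (D.dominoMatrix α β γ δ ε * Z) ![j, j + 1, n - 2, n] := by
  obtain ⟨b, hbm, hb⟩ := exists_columns hj1 hjn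
  obtain ⟨q, hq⟩ : ∃ q, ∀ l, D.tail l = j → q = D.head l := by
    by_cases hl : ∃ l, D.tail l = j
    · obtain ⟨l, hl⟩ := hl
      exact ⟨D.head l, fun m hm => by rw [D.tail_strictMono.injective (hl.trans hm.symm)]⟩
    · exact ⟨0, fun l hl' => absurd ⟨l, hl'⟩ hl⟩
  obtain ⟨f, hf, hr, hpos⟩ := h.exists_det_pos fun l hl => Or.inl (hq l hl)
  have hcol : ∀ s, (f s : ℕ) + 1 ≠ j ∧ (f s : ℕ) + 1 ≠ j + 1 ∧ (f s : ℕ) + 3 < n := fun s => by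
    obtain ⟨l, hl⟩ : (f s : ℕ) + 1 ∈ Set.range (D.column j q) := hr ▸ ⟨s, rfl⟩
    have h1 := D.tail_add_two_le_head l
    have h2 := D.head_add_two_le l
    have h3 := hD l
    have h4 := hq l
    unfold column at hl
    split_ifs at hl <;> omega
  rw [← one_mul (twistor _ _ _)]
  refine mul_twistor_pos (fun t => markerRow_eq (hb t)) (fun f hf => ?_) ⟨f, ?_⟩
  · rw [one_mul]
    exact det_mul_appendMinor_nonneg hZ hjn hbm hb h.isTotallyNonnegRect
      (h.dominoMatrix_eq_zero hD) hf
  · rw [one_mul]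
    refine mul_pos hpos (appendMinor_pos hZ hjn hbm hb hf (fun s => ?_) fun s => ?_)
    · have := hcol s
      exact forall_ne_columns hb (by omega) (by omega) (by omega) (by omega)
    · have := hcol s
      omega

theorem twistor_neg {l₀ : Fin k} (hl₀ : D.head l₀ = n - 2)
    (hmin : ∀ l, D.head l = n - 2 → D.tail l₀ ≤ D.tail l)
    (h : D.SignRules α β γ δ ε) {Z : Matrix (Fin n) (Fin (k + 4)) ℝ} (hZ : IsPositiveMatrix Z) :
    twistor Z (D.dominoMatrix α β γ δ ε * Z) ![D.tail l₀, D.tail l₀ + 1, n - 2, n] < 0 := by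
  have ht := D.tail_add_two_le_head l₀
  have hh := D.head_add_two_le l₀
  have hjn : D.tail l₀ + 4 ≤ n := by omega
  obtain ⟨b, hbm, hb⟩ := exists_columns (D.one_le_tail l₀) hjn
  have htop : D.IsTop l₀ := fun m hm => by
    have h1 := D.head_add_two_le m
    have h2 := hm.2
    exact absurd hm.1 (hmin m (by omega)).not_gt
  have hq : ∀ l, D.tail l = D.tail l₀ → n - 1 = D.head l + 1 ∧ n ≤ D.head l + 2 := fun l hl => by
    rw [D.tail_strictMono.injective hl]
    omega
  obtain ⟨f, hf, hr, hpos⟩ := h.exists_det_pos fun l hl => Or.inr (hq l hl)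
  have hcol : ∀ s, (f s : ℕ) + 1 ≠ D.tail l₀ ∧ (f s : ℕ) + 1 ≠ D.tail l₀ + 1 ∧
      (f s : ℕ) + 1 ≠ n - 2 ∧ (f s : ℕ) + 1 ≠ n := fun s => by
    obtain ⟨l, hl⟩ : (f s : ℕ) + 1 ∈ Set.range (D.column (D.tail l₀) (n - 1)) := hr ▸ ⟨s, rfl⟩
    have h1 := D.tail_add_two_le_head l
    have h2 := D.head_add_two_le l
    unfold column at hl
    split_ifs at hl <;> omega
  obtain ⟨s, hs⟩ : D.column (D.tail l₀) (n - 1) l₀ ∈ Set.range fun t => (f t : ℕ) + 1 :=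
    hr ▸ ⟨l₀, rfl⟩
  rw [column, if_neg (lt_irrefl _), if_pos rfl] at hs
  rw [← neg_pos, ← neg_one_mul]
  refine mul_twistor_pos (fun t => markerRow_eq (hb t)) (fun f hf => ?_) ⟨f, ?_⟩
  · rw [neg_one_mul, ← mul_neg]
    by_cases hfb : ∀ s t, f s ≠ b t
    · by_cases h' : ∀ s, (f s : ℕ) + 2 ≠ n
      · rw [Matrix.det_eq_zero_of_row_eq_zero l₀ fun s => ?_, zero_mul]
        have h0 := Fin.val_ne_iff.2 (hfb s 0)
        have h1 := Fin.val_ne_iff.2 (hfb s 1)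
        have h2 := Fin.val_ne_iff.2 (hfb s 2)
        have h3 := Fin.val_ne_iff.2 (hfb s 3)
        have b0 := hb 0
        have b1 := hb 1
        have b2 := hb 2
        have b3 := hb 3
        simp at b0 b1 b2 b3
        have h4 := h' s
        exact (h.dominoMatrix_apply l₀ (f s)).trans (htop.signedRow_eq_zero _ _ _ _ _ (by omega)
          (by omega) (by omega) (by omega) (by omega))
      · push Not at h'
        obtain ⟨s, hs⟩ := h'
        exact mul_nonneg (h.isTotallyNonnegRect f hf)
          (neg_nonneg.2 (appendMinor_neg hZ hjn hbm hb hf hfb hs).le)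
    · push Not at hfb
      obtain ⟨s, t, hst⟩ := hfb
      rw [appendMinor_eq_zero Z hst, neg_zero, mul_zero]
  · rw [neg_one_mul, ← mul_neg]
    refine mul_pos hpos (neg_pos.2 (appendMinor_neg hZ hjn hbm hb hf (fun s => ?_)
      (s := s) ?_))
    · obtain ⟨h1, h2, h3, h4⟩ := hcol s
      exact forall_ne_columns hb h1 h2 h3 h4
    · change (f s : ℕ) + 1 = n - 1 at hs
      omega

end ChordDiagram

/-- (a) If `C` is totally nonnegative of rank `k` with zero
`(n-1)`-th column, then `⟨(CZ) j (j+1) (n-2) n⟩ ≥ 0` for `1 ≤ j ≤ n - 4` and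
positive `Z`.  (b) If the chord diagram `D` has no chord ending at `(n-2, n-1)`, this
twistor is strictly positive on the BCFW cell of `D`, for every positive `Z`.
(c) If `D` has a chord ending at `(n-2, n-1)`, there is `1 ≤ j ≤ n - 4` for which this
twistor is strictly negative on the BCFW cell of `D`, for every positive `Z`. -/
theorem twistor_j_jp1_nm2_n_signs
    (n k : ℕ) (hk : 1 ≤ k) (hn : k + 4 ≤ n) :
    (∀ Z : Matrix (Fin n) (Fin (k + 4)) ℝ, IsPositiveMatrix Z →
      ∀ C : Matrix (Fin k) (Fin n) ℝ, IsTotallyNonnegRect C → C.rank = k →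
        (∀ r : Fin k, ∀ a : Fin n, (a : ℕ) + 1 = n - 1 → C r a = 0) →
        ∀ j : ℕ, 1 ≤ j → j ≤ n - 4 →
          0 ≤ twistor Z (C * Z) ![j, j + 1, n - 2, n]) ∧
    (∀ D : ChordDiagram n k, (∀ l, D.head l ≠ n - 2) →
      ∀ j : ℕ, 1 ≤ j → j ≤ n - 4 →
        ∀ α β γ δ ε : Fin k → ℝ, D.SignRules α β γ δ ε →
          ∀ Z : Matrix (Fin n) (Fin (k + 4)) ℝ, IsPositiveMatrix Z →
            0 < twistor Z (D.dominoMatrix α β γ δ ε * Z) ![j, j + 1, n - 2, n]) ∧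
    (∀ D : ChordDiagram n k, (∃ l, D.head l = n - 2) →
      ∃ j : ℕ, 1 ≤ j ∧ j ≤ n - 4 ∧
        ∀ α β γ δ ε : Fin k → ℝ, D.SignRules α β γ δ ε →
          ∀ Z : Matrix (Fin n) (Fin (k + 4)) ℝ, IsPositiveMatrix Z →
            twistor Z (D.dominoMatrix α β γ δ ε * Z) ![j, j + 1, n - 2, n] < 0) := by
  refine ⟨fun Z hZ C hC _ hC0 j hj1 hjn => ?_, fun D hD j hj1 hjn α β γ δ ε h Z hZ => ?_,
    fun D hD => ?_⟩
  · obtain ⟨b, hbm, hb⟩ := exists_columns (n := n) hj1 (by omega)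
    rw [← one_mul (twistor _ _ _)]
    refine mul_twistor_nonneg (fun t => markerRow_eq (hb t)) fun f hf => ?_
    rw [one_mul]
    exact det_mul_appendMinor_nonneg hZ (by omega) hbm hb hC hC0 hf
  · exact ChordDiagram.twistor_pos hD hj1 (by omega) h hZ
  · obtain ⟨l₀, hl₀, hmin⟩ := (Finset.univ.filter fun l => D.head l = n - 2).exists_min_image
      D.tail (by obtain ⟨l, hl⟩ := hD; exact ⟨l, by simpa using hl⟩)
    have hl₀' : D.head l₀ = n - 2 := by simpa using hl₀
    have ht := D.tail_add_two_le_head l₀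
    exact ⟨D.tail l₀, D.one_le_tail l₀, by omega, fun α β γ δ ε h Z hZ =>
      ChordDiagram.twistor_neg hl₀' (fun l hl => hmin l (by simpa using hl)) h hZ⟩

end
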